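/- Let γ₀ : [0,1] → ℝ² be an unconstrained minimizing geodesic joining p₋ to p₊, i.e. a locally Lipschitz curve with γ₀(0) = p₋, γ₀(1) = p₊ minimizing E among all such curves. Then there exists ε₀ > 0 such that for every A in the interval (𝒜(γ₀) − ε₀, 𝒜(γ₀) + ε₀), the isoperimetric problem with constraint A has a solution. -/

import Mathlib

open MeasureTheory Set Filter Topology
open scoped ENNReal

noncomputable section

/-- The Euclidean norm of a vector in `ℝ × ℝ`. -/
def enorm2 (v : ℝ × ℝ) : ℝ := Real.sqrt (v.1 ^ 2 + v.2 ^ 2)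

/-- The degenerate length `E(γ) = ∫ₐᵇ F(γ(t)) |γ'(t)| dt` of a planar curve. -/
def degLen (F : ℝ × ℝ → ℝ) (a b : ℝ) (γ : ℝ → ℝ × ℝ) : ℝ :=
  ∫ t in a..b, F (γ t) * enorm2 (deriv γ t)

/-- The signed area `𝒜(γ) = ∫ₐᵇ γ¹(t) (γ²)'(t) dt` of a planar curve. -/
def sArea (a b : ℝ) (γ : ℝ → ℝ × ℝ) : ℝ :=
  ∫ t in a..b, (γ t).1 * deriv (fun s => (γ s).2) t

/-- A locally Lipschitz curve on `[a,b]` joining `p` to `q`. -/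
def IsCurve (a b : ℝ) (γ : ℝ → ℝ × ℝ) (p q : ℝ × ℝ) : Prop :=
  a ≤ b ∧ LocallyLipschitz γ ∧ γ a = p ∧ γ b = q

/-- The standing hypotheses on the potential `W`: smooth, nonnegative, vanishing exactly at the
two distinct wells `pm` and `pp`, with positive definite Hessians there, and bounded away from
zero near infinity (`liminf_{|p|→∞} W(p) > 0`). -/
structure TwoWell (W : ℝ × ℝ → ℝ) (pm pp : ℝ × ℝ) : Prop where
  smooth : ContDiff ℝ (⊤ : ℕ∞) W
  nonneg : ∀ p, 0 ≤ W p
  wells_ne : pm ≠ pp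
  zeroSet : ∀ p, W p = 0 ↔ p = pm ∨ p = pp
  hess_m : ∀ v : ℝ × ℝ, v ≠ 0 → 0 < iteratedFDeriv ℝ 2 W pm ![v, v]
  hess_p : ∀ v : ℝ × ℝ, v ≠ 0 → 0 < iteratedFDeriv ℝ 2 W pp ![v, v]
  coercive : ∃ c > 0, ∃ R : ℝ, ∀ p : ℝ × ℝ, R ≤ ‖p‖ → c ≤ W p

/-- `γ : [a,b] → ℝ²` solves the isoperimetric problem with constraint `A`: it is a locally
Lipschitz curve from `pm` to `pp` with signed area `A` minimizing the degenerate length `E`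
among all such curves. -/
def IsoSol (F : ℝ × ℝ → ℝ) (pm pp : ℝ × ℝ) (A : ℝ) (a b : ℝ) (γ : ℝ → ℝ × ℝ) : Prop :=
  IsCurve a b γ pm pp ∧ sArea a b γ = A ∧
  ∀ a' b' γ', IsCurve a' b' γ' pm pp → sArea a' b' γ' = A →
    degLen F a b γ ≤ degLen F a' b' γ'

open scoped NNReal

section

lemma enorm2_nonneg (v : ℝ × ℝ) : 0 ≤ enorm2 v := Real.sqrt_nonneg _

lemma norm_le_enorm2 (v : ℝ × ℝ) : ‖v‖ ≤ enorm2 v := by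
  rw [Prod.norm_def]
  refine max_le ?_ ?_
  · exact Real.le_sqrt_of_sq_le (by rw [Real.norm_eq_abs, sq_abs]; nlinarith [sq_nonneg v.2])
  · exact Real.le_sqrt_of_sq_le (by rw [Real.norm_eq_abs, sq_abs]; nlinarith [sq_nonneg v.1])

lemma enorm2_le (v : ℝ × ℝ) : enorm2 v ≤ 2 * ‖v‖ := by
  unfold enorm2
  apply Real.sqrt_le_iff.2
  have h1 : |v.1| ≤ ‖v‖ := norm_fst_le v
  have h2 : |v.2| ≤ ‖v‖ := norm_snd_le v
  have := abs_nonneg v.1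
  have := abs_nonneg v.2
  refine ⟨by positivity, ?_⟩
  rw [← sq_abs v.1, ← sq_abs v.2]
  nlinarith [norm_nonneg v]

lemma enorm2_smul (c : ℝ) (v : ℝ × ℝ) : enorm2 (c • v) = |c| * enorm2 v := by
  unfold enorm2
  rw [← Real.sqrt_sq_eq_abs, ← Real.sqrt_mul (sq_nonneg c)]
  congr 1
  simp; ring

lemma continuous_enorm2 : Continuous enorm2 := by
  unfold enorm2; fun_prop

lemma enorm2_zero : enorm2 0 = 0 := by simp [enorm2]

lemma ftc_on {f : ℝ → ℝ} {a b : ℝ} {K : ℝ≥0} (hab : a ≤ b) (hf : LipschitzOnWith K f (Icc a b)) :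
    ∫ t in a..b, deriv f t = f b - f a := by
  rw [← uIcc_of_le hab] at hf
  exact hf.absolutelyContinuousOnInterval.integral_deriv_eq_sub

lemma sub_le_int {f g : ℝ → ℝ} {a b : ℝ} {K : ℝ≥0} (hab : a ≤ b)
    (hf : LipschitzOnWith K f (Icc a b)) (hg : IntervalIntegrable g volume a b)
    (h : ∀ᵐ t, t ∈ Ioo a b → deriv f t ≤ g t) : f b - f a ≤ ∫ t in a..b, g t := by
  rw [← ftc_on hab hf]
  have hi : IntervalIntegrable (deriv f) volume a b := by
    rw [← uIcc_of_le hab] at hf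
    exact hf.absolutelyContinuousOnInterval.intervalIntegrable_deriv
  apply intervalIntegral.integral_mono_ae_restrict hab hi hg
  rw [← Measure.restrict_congr_set Ioo_ae_eq_Icc]
  exact (ae_restrict_iff' measurableSet_Ioo).2 h

lemma int_le_sub {f g : ℝ → ℝ} {a b : ℝ} {K : ℝ≥0} (hab : a ≤ b)
    (hf : LipschitzOnWith K f (Icc a b)) (hg : IntervalIntegrable g volume a b)
    (h : ∀ᵐ t, t ∈ Ioo a b → g t ≤ deriv f t) : ∫ t in a..b, g t ≤ f b - f a := by
  rw [← ftc_on hab hf]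
  have hi : IntervalIntegrable (deriv f) volume a b := by
    rw [← uIcc_of_le hab] at hf
    exact hf.absolutelyContinuousOnInterval.intervalIntegrable_deriv
  apply intervalIntegral.integral_mono_ae_restrict hab hg hi
  rw [← Measure.restrict_congr_set Ioo_ae_eq_Icc]
  exact (ae_restrict_iff' measurableSet_Ioo).2 h

lemma int_congr_Ioo {f g : ℝ → ℝ} {a b : ℝ} (hab : a ≤ b)
    (h : ∀ᵐ t, t ∈ Ioo a b → f t = g t) : ∫ t in a..b, f t = ∫ t in a..b, g t := by
  rw [intervalIntegral.integral_of_le hab, intervalIntegral.integral_of_le hab,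
    ← Measure.restrict_congr_set Ioo_ae_eq_Ioc]
  exact integral_congr_ae ((ae_restrict_iff' measurableSet_Ioo).2 h)

lemma int_mono_Ioo {f g : ℝ → ℝ} {a b : ℝ} (hab : a ≤ b) (hf : IntervalIntegrable f volume a b)
    (hg : IntervalIntegrable g volume a b)
    (h : ∀ᵐ t, t ∈ Ioo a b → f t ≤ g t) : ∫ t in a..b, f t ≤ ∫ t in a..b, g t := by
  apply intervalIntegral.integral_mono_ae_restrict hab hf hg
  rw [← Measure.restrict_congr_set Ioo_ae_eq_Icc]
  exact (ae_restrict_iff' measurableSet_Ioo).2 h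

lemma intg_of_bdd {f : ℝ → ℝ} (hf : Measurable f) {a b : ℝ}
    (hb : ∃ M, ∀ t ∈ uIcc a b, |f t| ≤ M) :
    IntervalIntegrable f volume a b := by
  obtain ⟨M, hM⟩ := hb
  rw [intervalIntegrable_iff]
  refine Measure.integrableOn_of_bounded (M := M) (by simp) hf.aestronglyMeasurable ?_
  exact (ae_restrict_iff' measurableSet_uIoc).2 (ae_of_all _ fun t ht => hM t (uIoc_subset_uIcc ht))

lemma cont_bdd {f : ℝ → ℝ} (hf : Continuous f) (a b : ℝ) : ∃ M, 0 ≤ M ∧ ∀ t ∈ uIcc a b, |f t| ≤ M := by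
  obtain ⟨M, hM⟩ := isCompact_uIcc.exists_bound_of_continuousOn (hf.continuousOn (s := uIcc a b))
  exact ⟨M, (norm_nonneg _).trans (hM a left_mem_uIcc), hM⟩

section curve
variable {γ : ℝ → ℝ × ℝ} {K : ℝ≥0}

lemma deriv_bd (hγ : LipschitzWith K γ) (t : ℝ) : ‖deriv γ t‖ ≤ K :=
  norm_deriv_le_of_lipschitz hγ

lemma lip_fst (hγ : LipschitzWith K γ) : LipschitzWith K (fun t => (γ t).1) := by
  have h := (LipschitzWith.prod_fst (α := ℝ) (β := ℝ)).comp hγ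
  rw [one_mul] at h
  exact h

lemma lip_snd (hγ : LipschitzWith K γ) : LipschitzWith K (fun t => (γ t).2) := by
  have h := (LipschitzWith.prod_snd (α := ℝ) (β := ℝ)).comp hγ
  rw [one_mul] at h
  exact h

lemma deriv2_bd (hγ : LipschitzWith K γ) (t : ℝ) : |deriv (fun s => (γ s).2) t| ≤ K :=
  norm_deriv_le_of_lipschitz (lip_snd hγ)

lemma meas_eD {F : ℝ × ℝ → ℝ} (hF : Continuous F) (hγ : LipschitzWith K γ) :
    Measurable (fun t => F (γ t) * enorm2 (deriv γ t)) :=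
  ((hF.comp hγ.continuous).measurable).mul (continuous_enorm2.measurable.comp (measurable_deriv γ))

lemma bd_eD {F : ℝ × ℝ → ℝ} (hF : Continuous F) (hγ : LipschitzWith K γ) (a b : ℝ) :
    ∃ M, ∀ t ∈ uIcc a b, |F (γ t) * enorm2 (deriv γ t)| ≤ M := by
  obtain ⟨M, hM0, hM⟩ := cont_bdd (hF.comp hγ.continuous) a b
  refine ⟨M * (2 * K), fun t ht => ?_⟩
  rw [abs_mul, abs_of_nonneg (enorm2_nonneg _)]
  exact mul_le_mul (hM t ht) ((enorm2_le _).trans (by linarith [deriv_bd hγ t])) (enorm2_nonneg _) hM0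

lemma intg_eD {F : ℝ × ℝ → ℝ} (hF : Continuous F) (hγ : LipschitzWith K γ) (a b : ℝ) :
    IntervalIntegrable (fun t => F (γ t) * enorm2 (deriv γ t)) volume a b :=
  intg_of_bdd (meas_eD hF hγ) (bd_eD hF hγ a b)

lemma meas_aD (hγ : LipschitzWith K γ) :
    Measurable (fun t => (γ t).1 * deriv (fun s => (γ s).2) t) :=
  ((lip_fst hγ).continuous.measurable).mul (measurable_deriv _)

lemma bd_aD (hγ : LipschitzWith K γ) (a b : ℝ) :
    ∃ M, ∀ t ∈ uIcc a b, |(γ t).1 * deriv (fun s => (γ s).2) t| ≤ M := by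
  obtain ⟨M, hM0, hM⟩ := cont_bdd (lip_fst hγ).continuous a b
  refine ⟨M * K, fun t ht => ?_⟩
  rw [abs_mul]
  exact mul_le_mul (hM t ht) (deriv2_bd hγ t) (abs_nonneg _) hM0

lemma intg_aD (hγ : LipschitzWith K γ) (a b : ℝ) :
    IntervalIntegrable (fun t => (γ t).1 * deriv (fun s => (γ s).2) t) volume a b :=
  intg_of_bdd (meas_aD hγ) (bd_aD hγ a b)

lemma intg_len (hγ : LipschitzWith K γ) (a b : ℝ) :
    IntervalIntegrable (fun t => ‖deriv γ t‖) volume a b :=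
  intg_of_bdd (measurable_deriv γ).norm ⟨K, fun t _ => by rw [abs_norm]; exact deriv_bd hγ t⟩

/-- sup-norm length -/
def Len (a b : ℝ) (γ : ℝ → ℝ × ℝ) : ℝ := ∫ t in a..b, ‖deriv γ t‖

lemma ae_diff (hγ : LipschitzWith K γ) : ∀ᵐ t, DifferentiableAt ℝ γ t := hγ.ae_differentiableAt

lemma deriv_snd {t : ℝ} (h : DifferentiableAt ℝ γ t) :
    deriv (fun s => (γ s).2) t = (deriv γ t).2 := by
  have := (hasFDerivAt_snd (𝕜 := ℝ) (p := γ t)).comp_hasDerivAt t h.hasDerivAt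
  exact this.deriv

lemma deriv_fst {t : ℝ} (h : DifferentiableAt ℝ γ t) :
    deriv (fun s => (γ s).1) t = (deriv γ t).1 := by
  have := (hasFDerivAt_fst (𝕜 := ℝ) (p := γ t)).comp_hasDerivAt t h.hasDerivAt
  exact this.deriv

lemma deriv_congr_Ioo {E : Type*} [NormedAddCommGroup E] [NormedSpace ℝ E] {γ γ' : ℝ → E} {a b : ℝ} (h : ∀ t ∈ Ioo a b, γ t = γ' t) {t : ℝ} (ht : t ∈ Ioo a b) :
    deriv γ t = deriv γ' t :=
  Filter.EventuallyEq.deriv_eq (by filter_upwards [Ioo_mem_nhds ht.1 ht.2] with s hs using h s hs)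

lemma degLen_congr {F : ℝ × ℝ → ℝ} {γ γ' : ℝ → ℝ × ℝ} {a b : ℝ} (hab : a ≤ b)
    (h : ∀ t ∈ Ioo a b, γ t = γ' t) : degLen F a b γ = degLen F a b γ' :=
  int_congr_Ioo hab (ae_of_all _ fun t ht => by rw [h t ht, deriv_congr_Ioo h ht])

lemma sArea_congr {γ γ' : ℝ → ℝ × ℝ} {a b : ℝ} (hab : a ≤ b)
    (h : ∀ t ∈ Ioo a b, γ t = γ' t) : sArea a b γ = sArea a b γ' :=
  int_congr_Ioo hab (ae_of_all _ fun t ht => by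
    rw [h t ht, deriv_congr_Ioo (γ := fun s => (γ s).2) (γ' := fun s => (γ' s).2)
      (fun s hs => by rw [h s hs]) ht])

lemma Len_congr {γ γ' : ℝ → ℝ × ℝ} {a b : ℝ} (hab : a ≤ b)
    (h : ∀ t ∈ Ioo a b, γ t = γ' t) : Len a b γ = Len a b γ' :=
  int_congr_Ioo hab (ae_of_all _ fun t ht => by rw [deriv_congr_Ioo h ht])

lemma degLen_add {F : ℝ × ℝ → ℝ} (hF : Continuous F) (hγ : LipschitzWith K γ) (a b c : ℝ) :
    degLen F a b γ + degLen F b c γ = degLen F a c γ :=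
  intervalIntegral.integral_add_adjacent_intervals (intg_eD hF hγ _ _) (intg_eD hF hγ _ _)

lemma sArea_add (hγ : LipschitzWith K γ) (a b c : ℝ) :
    sArea a b γ + sArea b c γ = sArea a c γ :=
  intervalIntegral.integral_add_adjacent_intervals (intg_aD hγ _ _) (intg_aD hγ _ _)

lemma Len_add (hγ : LipschitzWith K γ) (a b c : ℝ) :
    Len a b γ + Len b c γ = Len a c γ :=
  intervalIntegral.integral_add_adjacent_intervals (intg_len hγ _ _) (intg_len hγ _ _)

lemma degLen_nonneg {F : ℝ × ℝ → ℝ} (hF0 : ∀ p, 0 ≤ F p) {a b : ℝ} (hab : a ≤ b) :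
    0 ≤ degLen F a b γ :=
  intervalIntegral.integral_nonneg hab fun _ _ => mul_nonneg (hF0 _) (enorm2_nonneg _)

lemma Len_nonneg {a b : ℝ} (hab : a ≤ b) : 0 ≤ Len a b γ :=
  intervalIntegral.integral_nonneg hab fun _ _ => norm_nonneg _

/-- clip a locally Lipschitz curve to a globally Lipschitz one -/
lemma clip {a b : ℝ} (hab : a ≤ b) (h : LocallyLipschitz γ) :
    ∃ γ' : ℝ → ℝ × ℝ, (∃ K, LipschitzWith K γ') ∧ ∀ t ∈ Icc a b, γ' t = γ t := by
  obtain ⟨K, hK⟩ := (h.locallyLipschitzOn (s := Icc a b)).exists_lipschitzOnWith_of_compact isCompact_Icc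
  refine ⟨IccExtend hab ((Icc a b).domRestrict γ), ⟨K, ?_⟩, fun t ht => by simp [IccExtend_of_mem hab _ ht]⟩
  have h2 := (lipschitzOnWith_iff_restrict.1 hK).comp (LipschitzWith.projIcc hab)
  rw [mul_one] at h2
  exact h2

/-- Lower bound of the cost by a function with slope at most `F`. -/
lemma slope_bound {F : ℝ × ℝ → ℝ} (hF : Continuous F) (hF0 : ∀ p, 0 ≤ F p) (hγ : LipschitzWith K γ)
    {φ : ℝ × ℝ → ℝ} {M : ℝ≥0} (hφ : LipschitzWith M φ)
    (hs : ∀ x, ∀ ε > 0, ∀ᶠ y in 𝓝 x, |φ y - φ x| ≤ (F x + ε) * ‖y - x‖) {s t : ℝ} (hst : s ≤ t) :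
    |φ (γ t) - φ (γ s)| ≤ degLen F s t γ := by
  have key : ∀ᵐ u, |deriv (fun v => φ (γ v)) u| ≤ F (γ u) * enorm2 (deriv γ u) := by
    filter_upwards [ae_diff hγ] with u hu
    by_cases hd : DifferentiableAt ℝ (fun v => φ (γ v)) u
    swap
    · rw [deriv_zero_of_not_differentiableAt hd]; simp
      exact mul_nonneg (hF0 _) (enorm2_nonneg _)
    have h1 : Tendsto (fun v => |slope (fun v => φ (γ v)) u v|) (𝓝[≠] u)
        (𝓝 |deriv (fun v => φ (γ v)) u|) := (hasDerivAt_iff_tendsto_slope.1 hd.hasDerivAt).abs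
    have h2 : Tendsto (fun v => ‖slope γ u v‖) (𝓝[≠] u) (𝓝 ‖deriv γ u‖) :=
      (hasDerivAt_iff_tendsto_slope.1 hu.hasDerivAt).norm
    have h3 : ∀ ε > 0, |deriv (fun v => φ (γ v)) u| ≤ (F (γ u) + ε) * ‖deriv γ u‖ := by
      intro ε hε
      refine le_of_tendsto_of_tendsto h1 (h2.const_mul _) ?_
      have h4 := (hγ.continuous.tendsto u).eventually (hs (γ u) ε hε)
      filter_upwards [h4.filter_mono nhdsWithin_le_nhds] with v hv
      rw [slope_def_module, slope_def_module, norm_smul, smul_eq_mul, abs_mul, Real.norm_eq_abs]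
      calc _ ≤ |(v - u)⁻¹| * ((F (γ u) + ε) * ‖γ v - γ u‖) := by gcongr
        _ = _ := by ring
    have h5 : |deriv (fun v => φ (γ v)) u| ≤ F (γ u) * ‖deriv γ u‖ := by
      refine le_of_forall_pos_le_add fun ε hε => ?_
      have := h3 (ε / (K + 1)) (by positivity)
      have hb := deriv_bd hγ u
      have : ε / (K + 1) * ‖deriv γ u‖ ≤ ε := by
        rw [div_mul_eq_mul_div, div_le_iff₀ (by positivity)]
        nlinarith
      nlinarith
    exact h5.trans (mul_le_mul_of_nonneg_left (norm_le_enorm2 _) (hF0 _))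
  have hl : LipschitzOnWith (M * K) (fun v => φ (γ v)) (Icc s t) := (hφ.comp hγ).lipschitzOnWith
  have i := intg_eD hF hγ s t
  rw [abs_le]
  constructor
  · have := int_le_sub hst hl i.neg (by filter_upwards [key] with u hu _ using (abs_le.1 hu).1)
    simp only [Pi.neg_apply, intervalIntegral.integral_neg] at this
    exact this
  · exact sub_le_int hst hl i (by filter_upwards [key] with u hu _ using (abs_le.1 hu).2)

end curve

end

section

section
variable {γ : ℝ → ℝ × ℝ} {K : ℝ≥0}

lemma lin_bound (hγ : LipschitzWith K γ) (c₁ c₂ : ℝ) {s t : ℝ} (hst : s ≤ t) {g : ℝ → ℝ}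
    (hg : IntervalIntegrable g volume s t)
    (h : ∀ᵐ u, u ∈ Ioo s t → c₁ * (deriv γ u).1 + c₂ * (deriv γ u).2 ≤ g u) :
    c₁ * ((γ t).1 - (γ s).1) + c₂ * ((γ t).2 - (γ s).2) ≤ ∫ u in s..t, g u := by
  have hl : LipschitzWith (Real.toNNReal (|c₁| * K + |c₂| * K))
      (fun u => c₁ * (γ u).1 + c₂ * (γ u).2) := by
    apply LipschitzWith.of_dist_le'
    intro x y
    have h1 := (lip_fst hγ).dist_le_mul x y
    have h2 := (lip_snd hγ).dist_le_mul x y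
    simp only [Real.dist_eq] at *
    calc |c₁ * (γ x).1 + c₂ * (γ x).2 - (c₁ * (γ y).1 + c₂ * (γ y).2)|
        = |c₁ * ((γ x).1 - (γ y).1) + c₂ * ((γ x).2 - (γ y).2)| := by congr 1; ring
      _ ≤ |c₁| * |(γ x).1 - (γ y).1| + |c₂| * |(γ x).2 - (γ y).2| := by
          rw [← abs_mul, ← abs_mul]; exact abs_add_le _ _
      _ ≤ |c₁| * (K * |x - y|) + |c₂| * (K * |x - y|) := by gcongr
      _ = _ := by ring
  have := sub_le_int hst (hl.lipschitzOnWith (s := Icc s t)) hg (by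
    filter_upwards [h, ae_diff hγ] with u hu hd hm
    have e1 := (hasFDerivAt_fst (𝕜 := ℝ) (p := γ u)).comp_hasDerivAt u hd.hasDerivAt
    have e2 := (hasFDerivAt_snd (𝕜 := ℝ) (p := γ u)).comp_hasDerivAt u hd.hasDerivAt
    have e3 := ((e1.const_mul c₁).add (e2.const_mul c₂)).deriv
    have e4 : deriv (fun u => c₁ * (γ u).1 + c₂ * (γ u).2) u =
        c₁ * (deriv γ u).1 + c₂ * (deriv γ u).2 := e3
    rw [e4]; exact hu hm)
  linarith

lemma norm_sub_le_Len (hγ : LipschitzWith K γ) {s t : ℝ} (hst : s ≤ t) :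
    ‖γ t - γ s‖ ≤ Len s t γ := by
  have hb1 : ∀ u, |(deriv γ u).1| ≤ ‖deriv γ u‖ := fun u => norm_fst_le (deriv γ u)
  have hb2 : ∀ u, |(deriv γ u).2| ≤ ‖deriv γ u‖ := fun u => norm_snd_le (deriv γ u)
  have i := intg_len hγ s t
  have a1 := lin_bound hγ 1 0 hst i (ae_of_all _ fun u _ => by linarith [le_abs_self (deriv γ u).1, hb1 u])
  have a2 := lin_bound hγ (-1) 0 hst i (ae_of_all _ fun u _ => by linarith [neg_abs_le (deriv γ u).1, hb1 u])
  have a3 := lin_bound hγ 0 1 hst i (ae_of_all _ fun u _ => by linarith [le_abs_self (deriv γ u).2, hb2 u])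
  have a4 := lin_bound hγ 0 (-1) hst i (ae_of_all _ fun u _ => by linarith [neg_abs_le (deriv γ u).2, hb2 u])
  rw [Prod.norm_def]
  unfold Len
  refine max_le ?_ ?_
  · rw [Real.norm_eq_abs, Prod.fst_sub, abs_le]; constructor <;> linarith
  · rw [Real.norm_eq_abs, Prod.snd_sub, abs_le]; constructor <;> linarith

lemma inner_le_enorm2 (v w : ℝ × ℝ) : v.1 * w.1 + v.2 * w.2 ≤ enorm2 v * enorm2 w := by
  unfold enorm2
  rw [← Real.sqrt_mul (by positivity)]
  apply Real.le_sqrt_of_sq_le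
  nlinarith [sq_nonneg (v.1 * w.2 - v.2 * w.1)]

lemma intg_enorm2 (hγ : LipschitzWith K γ) (a b : ℝ) :
    IntervalIntegrable (fun t => enorm2 (deriv γ t)) volume a b := by
  have := intg_eD (F := fun _ => 1) continuous_const hγ a b
  simpa using this

lemma enorm2_sub_le (hγ : LipschitzWith K γ) {s t : ℝ} (hst : s ≤ t) :
    enorm2 (γ t - γ s) ≤ ∫ u in s..t, enorm2 (deriv γ u) := by
  set w := γ t - γ s with hw
  rcases (enorm2_nonneg w).eq_or_lt with h0 | h0
  · rw [← h0]; exact intervalIntegral.integral_nonneg hst fun _ _ => enorm2_nonneg _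
  have := lin_bound hγ w.1 w.2 hst ((intg_enorm2 hγ s t).const_mul (enorm2 w))
    (ae_of_all _ fun u _ => inner_le_enorm2 w _)
  rw [intervalIntegral.integral_const_mul] at this
  have h2 : w.1 * ((γ t).1 - (γ s).1) + w.2 * ((γ t).2 - (γ s).2) = enorm2 w * enorm2 w := by
    unfold enorm2
    rw [Real.mul_self_sqrt (by positivity), hw]
    simp; ring
  rw [h2] at this
  exact le_of_mul_le_mul_left this h0

end

lemma prim_lip {d : ℝ → ℝ} {a b M : ℝ} (hab : a ≤ b) (hd : Measurable d)
    (hM : ∀ t ∈ Icc a b, |d t| ≤ M) :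
    LipschitzOnWith M.toNNReal (fun x => ∫ t in a..x, d t) (Icc a b) := by
  have hi : ∀ x ∈ Icc a b, ∀ y ∈ Icc a b, IntervalIntegrable d volume x y := fun x hx y hy =>
    intg_of_bdd hd ⟨M, fun t ht => hM t ((ordConnected_Icc.uIcc_subset hx hy) ht)⟩
  apply LipschitzOnWith.of_dist_le'
  intro x hx y hy
  have ha : a ∈ Icc a b := left_mem_Icc.2 hab
  rw [dist_eq_norm, intervalIntegral.integral_interval_sub_left (hi a ha x hx) (hi a ha y hy),
    Real.dist_eq]
  apply intervalIntegral.norm_integral_le_of_norm_le_const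
  intro t ht
  exact hM t ((ordConnected_Icc.uIcc_subset hy hx) (uIoc_subset_uIcc ht))

lemma prim_deriv {d : ℝ → ℝ} {a b M : ℝ} (hab : a ≤ b) (hd : Measurable d)
    (hM : ∀ t ∈ Icc a b, |d t| ≤ M) :
    ∀ᵐ x, x ∈ Icc a b → HasDerivAt (fun x => ∫ t in a..x, d t) (d x) x := by
  have := (intg_of_bdd (a := a) (b := b) hd ⟨M, by rwa [uIcc_of_le hab]⟩).ae_hasDerivAt_integral
  rw [uIcc_of_le hab] at this
  filter_upwards [this] with x hx hm using hx hm a (left_mem_Icc.2 hab)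

lemma ae_pull {P : ℝ → Prop} (hP : ∀ᵐ t, P t) {ψ s : ℝ → ℝ} {C : ℝ≥0} (hs : LipschitzWith C s)
    (h : ∀ u, s (ψ u) = u) : ∀ᵐ u, P (ψ u) := by
  rw [ae_iff] at hP ⊢
  refine measure_mono_null (t := s '' {t | ¬ P t}) (fun u hu => ⟨ψ u, hu, h u⟩) ?_
  have := hs.hausdorffMeasure_image_le (d := 1) zero_le_one {t | ¬ P t}
  rw [hausdorffMeasure_real, hP, mul_zero] at this
  exact le_antisymm this bot_le

lemma inv_int {d : ℝ → ℝ} {a b M : ℝ} (hab : a ≤ b) (hd : Measurable d)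
    (hM : ∀ t ∈ Icc a b, |d t| ≤ M) {ψ s : ℝ → ℝ} {C C' : ℝ≥0} (hψ : LipschitzWith C ψ)
    (hs : LipschitzWith C' s) (h : ∀ u, s (ψ u) = u) (hm : Monotone ψ) (h0 : ψ 0 = a) (h1 : ψ 1 = b) :
    ∫ u in (0:ℝ)..1, d (ψ u) * deriv ψ u = ∫ t in a..b, d t := by
  have hmaps : MapsTo ψ (Icc 0 1) (Icc a b) := fun u hu => ⟨h0 ▸ hm hu.1, h1 ▸ hm hu.2⟩
  have hl : LipschitzOnWith (M.toNNReal * C) (fun u => ∫ t in a..ψ u, d t) (Icc 0 1) :=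
    (prim_lip hab hd hM).comp hψ.lipschitzOnWith hmaps
  have := ftc_on zero_le_one hl
  simp only [h0, h1, intervalIntegral.integral_same, sub_zero] at this
  rw [← this]
  refine int_congr_Ioo zero_le_one ?_
  filter_upwards [ae_pull (prim_deriv hab hd hM) hs h, hψ.ae_differentiableAt] with u hu hdu hm
  have h3 := (hu (hmaps ⟨hm.1.le, hm.2.le⟩)).comp u hdu.hasDerivAt
  exact h3.deriv.symm

lemma reparam {F : ℝ × ℝ → ℝ} (hF : Continuous F) {γ : ℝ → ℝ × ℝ} {K : ℝ≥0} (hγ : LipschitzWith K γ)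
    {a b : ℝ} (hab : a < b) {L : ℝ≥0} (hL : Len a b γ < L) :
    ∃ γ' : ℝ → ℝ × ℝ, LipschitzWith L γ' ∧ γ' 0 = γ a ∧ γ' 1 = γ b ∧
      degLen F 0 1 γ' = degLen F a b γ ∧ sArea 0 1 γ' = sArea a b γ := by
  set ε : ℝ := (L - Len a b γ) / (b - a) with hε
  have hba : 0 < b - a := sub_pos.2 hab
  have hεp : 0 < ε := div_pos (sub_pos.2 hL) hba
  set s : ℝ → ℝ := fun t => (Len a t γ + ε * (t - a)) / L with hs
  have hLpos : (0:ℝ) < L := (Len_nonneg hab.le).trans_lt hL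
  have hdiff : ∀ x y, s y - s x = (Len x y γ + ε * (y - x)) / L := by
    intro x y
    simp only [hs]
    rw [← sub_div, ← Len_add hγ a x y]; ring
  have hlow : ∀ x y, x ≤ y → ε / L * (y - x) ≤ s y - s x := by
    intro x y hxy
    rw [hdiff, div_mul_eq_mul_div]
    apply div_le_div_of_nonneg_right _ hLpos.le
    linarith [Len_nonneg (γ := γ) hxy]
  have hup : ∀ x y, x ≤ y → s y - s x ≤ (K + ε) / L * (y - x) := by
    intro x y hxy
    rw [hdiff, div_mul_eq_mul_div ((K:ℝ) + ε)]
    apply div_le_div_of_nonneg_right _ hLpos.le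
    have : Len x y γ ≤ K * (y - x) := by
      have := intervalIntegral.integral_mono_on (g := fun _ => (K:ℝ)) hxy (intg_len hγ x y)
        intervalIntegrable_const (fun t _ => deriv_bd hγ t)
      simp only [intervalIntegral.integral_const, smul_eq_mul] at this
      unfold Len; linarith
    linarith
  have hgam : ∀ x y, x ≤ y → ‖γ y - γ x‖ ≤ L * (s y - s x) := by
    intro x y hxy
    rw [hdiff, mul_div_cancel₀ _ hLpos.ne']
    have := norm_sub_le_Len hγ hxy
    have : 0 ≤ ε * (y - x) := mul_nonneg hεp.le (sub_nonneg.2 hxy)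
    linarith
  have hεL : 0 < ε / L := div_pos hεp hLpos
  have hmono : StrictMono s := by
    intro x y hxy
    have := hlow x y hxy.le
    have : 0 < ε / L * (y - x) := mul_pos hεL (sub_pos.2 hxy)
    linarith
  have hslip : LipschitzWith ((K + ε) / L).toNNReal s := by
    apply LipschitzWith.of_dist_le'
    intro x y
    rcases le_total x y with h | h
    · rw [dist_comm, dist_comm x, Real.dist_eq, Real.dist_eq, abs_of_nonneg (by linarith [hmono.monotone h]), abs_of_nonneg (by linarith)]
      exact hup x y h
    · rw [Real.dist_eq, Real.dist_eq, abs_of_nonneg (by linarith [hmono.monotone h]), abs_of_nonneg (by linarith)]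
      exact hup y x h
  have hsurj : Function.Surjective s := by
    apply hslip.continuous.surjective
    · apply tendsto_atTop_mono' _ (f₁ := fun y => ε / L * (y - a) + s a)
      · filter_upwards [eventually_ge_atTop a] with y hy
        linarith [hlow a y hy]
      · exact tendsto_atTop_add_const_right _ _ (Tendsto.const_mul_atTop hεL (tendsto_atTop_add_const_right _ _ tendsto_id))
    · apply tendsto_atBot_mono' _ (f₁ := fun y => ε / L * (y - a) + s a)
      · filter_upwards [eventually_le_atBot a] with y hy
        linarith [hlow y a hy]
      · exact tendsto_atBot_add_const_right _ _ (Tendsto.const_mul_atBot hεL (tendsto_atBot_add_const_right _ _ tendsto_id))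
  set ψ := Function.surjInv hsurj
  have hψ : ∀ u, s (ψ u) = u := Function.surjInv_eq hsurj
  have hψm : Monotone ψ := by
    intro u v huv
    rw [← hmono.le_iff_le, hψ, hψ]; exact huv
  have hψs : ∀ t, ψ (s t) = t := fun t => hmono.injective (hψ _)
  have hψ0 : ψ 0 = a := by
    rw [← hψs a]; congr 1; simp [hs, Len]
  have hψ1 : ψ 1 = b := by
    rw [← hψs b]; congr 1
    simp only [hs, hε]
    rw [div_mul_cancel₀ _ hba.ne']
    rw [add_sub_cancel, div_self hLpos.ne']
  have hψl : LipschitzWith (L / ε).toNNReal ψ := by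
    apply LipschitzWith.of_dist_le'
    have : ∀ x y, x ≤ y → ψ y - ψ x ≤ L / ε * (y - x) := by
      intro x y h
      have := hlow _ _ (hψm h)
      rw [hψ, hψ, div_mul_eq_mul_div, div_le_iff₀ hLpos] at this
      rw [div_mul_eq_mul_div, le_div_iff₀ hεp]
      linarith
    intro x y
    rcases le_total x y with h | h
    · rw [dist_comm, dist_comm x, Real.dist_eq, Real.dist_eq, abs_of_nonneg (by linarith [hψm h]), abs_of_nonneg (by linarith)]
      exact this x y h
    · rw [Real.dist_eq, Real.dist_eq, abs_of_nonneg (by linarith [hψm h]), abs_of_nonneg (by linarith)]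
      exact this y x h
  have hγ' : LipschitzWith L (fun u => γ (ψ u)) := by
    apply LipschitzWith.of_dist_le_mul
    intro x y
    rcases le_total x y with h | h
    · rw [dist_comm, dist_comm x, dist_eq_norm, Real.dist_eq, abs_of_nonneg (by linarith)]
      have := hgam _ _ (hψm h)
      rwa [hψ, hψ] at this
    · rw [dist_eq_norm, Real.dist_eq, abs_of_nonneg (by linarith)]
      have := hgam _ _ (hψm h)
      rwa [hψ, hψ] at this
  refine ⟨fun u => γ (ψ u), hγ', by simp [hψ0], by simp [hψ1], ?_, ?_⟩
  · obtain ⟨M, hM⟩ := bd_eD hF hγ a b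
    rw [uIcc_of_le hab.le] at hM
    unfold degLen
    rw [← inv_int hab.le (meas_eD hF hγ) hM hψl hslip hψ hψm hψ0 hψ1]
    refine int_congr_Ioo zero_le_one ?_
    filter_upwards [ae_pull (ae_diff hγ) hslip hψ, hψl.ae_differentiableAt] with u hu hdu _
    have h3 := (hu.hasDerivAt.scomp u hdu.hasDerivAt).deriv
    have h4 : deriv (fun u => γ (ψ u)) u = deriv ψ u • deriv γ (ψ u) := h3
    rw [h4, enorm2_smul, abs_of_nonneg (hψm.deriv_nonneg)]
    ring
  · obtain ⟨M, hM⟩ := bd_aD hγ a b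
    rw [uIcc_of_le hab.le] at hM
    unfold sArea
    rw [← inv_int hab.le (meas_aD hγ) hM hψl hslip hψ hψm hψ0 hψ1]
    refine int_congr_Ioo zero_le_one ?_
    filter_upwards [ae_pull (lip_snd hγ).ae_differentiableAt hslip hψ, hψl.ae_differentiableAt] with u hu hdu _
    have h3 := (hu.hasDerivAt.comp u hdu.hasDerivAt).deriv
    have h4 : deriv (fun u => (γ (ψ u)).2) u = deriv (fun s => (γ s).2) (ψ u) * deriv ψ u := h3
    rw [h4]
    ring

end

section

def clampI (t : ℝ) : ℝ := max 0 (min t 1)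

lemma clampI_mem (t : ℝ) : clampI t ∈ Icc (0:ℝ) 1 :=
  ⟨le_max_left _ _, max_le zero_le_one (min_le_right _ _)⟩

lemma clampI_of_mem {t : ℝ} (ht : t ∈ Icc (0:ℝ) 1) : clampI t = t := by
  unfold clampI; rw [min_eq_left ht.2, max_eq_right ht.1]

lemma clampI_lip : LipschitzWith 1 clampI :=
  (LipschitzWith.id.min_const 1).const_max 0

lemma lip_clamp {f : ℝ → ℝ} {C : ℝ≥0} (hf : LipschitzOnWith C f (Icc 0 1)) :
    LipschitzWith C (fun t => f (clampI t)) := by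
  have := hf.comp (clampI_lip.lipschitzOnWith (s := univ)) (fun t _ => clampI_mem t)
  rw [mul_one, lipschitzOnWith_univ] at this
  exact this

def goodSet (F : ℝ × ℝ → ℝ) (L M : ℝ≥0) (δ : ℝ → ℝ) (p q : ℝ × ℝ) (A : ℝ) :
    Set (ℝ → (ℝ × ℝ) × (ℝ × ℝ)) :=
  {Φ | LipschitzWith M Φ ∧ LipschitzWith L (fun t => (Φ t).1) ∧ Φ 0 = (p, (0, 0)) ∧
    (Φ 1).1 = q ∧ (Φ 1).2.2 = A ∧
    (∀ s t ε : ℝ, 0 < ε → 0 ≤ s → s ≤ t → t ≤ 1 → L * (t - s) < δ ε →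
      (F (Φ s).1 - ε) * enorm2 ((Φ t).1 - (Φ s).1) ≤ (Φ t).2.1 - (Φ s).2.1) ∧
    (∀ s t : ℝ, 0 ≤ s → s ≤ t → t ≤ 1 →
      |(Φ t).2.2 - (Φ s).2.2 - (Φ s).1.1 * ((Φ t).1.2 - (Φ s).1.2)| ≤ L ^ 2 * (t - s) ^ 2)}

lemma goodSet_compact {F : ℝ × ℝ → ℝ} (hF : Continuous F) (L M : ℝ≥0) (δ : ℝ → ℝ) (p q : ℝ × ℝ) (A : ℝ) :
    IsCompact (goodSet F L M δ p q A) := by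
  have hK : IsCompact (Set.pi univ fun t : ℝ => Metric.closedBall ((p, (0, 0)) : (ℝ × ℝ) × (ℝ × ℝ)) (M * |t|)) :=
    isCompact_univ_pi fun t => isCompact_closedBall _ _
  refine hK.of_isClosed_subset ?_ ?_
  · have c1 : ∀ t : ℝ, Continuous fun Φ : ℝ → (ℝ × ℝ) × (ℝ × ℝ) => (Φ t).1 := fun t => by fun_prop
    have c2 : ∀ t : ℝ, Continuous fun Φ : ℝ → (ℝ × ℝ) × (ℝ × ℝ) => (Φ t).2 := fun t => by fun_prop
    have hl2 : IsClosed {Φ : ℝ → (ℝ × ℝ) × (ℝ × ℝ) | LipschitzWith L (fun t => (Φ t).1)} := by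
      have hc : Continuous fun (Φ : ℝ → (ℝ × ℝ) × (ℝ × ℝ)) (t : ℝ) => (Φ t).1 := by fun_prop
      exact (isClosed_setOfPred_lipschitzWith L).preimage hc
    have h6 : IsClosed {Φ : ℝ → (ℝ × ℝ) × (ℝ × ℝ) | ∀ s t ε : ℝ, 0 < ε → 0 ≤ s → s ≤ t → t ≤ 1 → L * (t - s) < δ ε →
      (F (Φ s).1 - ε) * enorm2 ((Φ t).1 - (Φ s).1) ≤ (Φ t).2.1 - (Φ s).2.1} := by
      simp only [Set.ofPred_forall]
      refine isClosed_iInter fun s => isClosed_iInter fun t => isClosed_iInter fun ε => isClosed_iInter fun _ =>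
        isClosed_iInter fun _ => isClosed_iInter fun _ => isClosed_iInter fun _ => isClosed_iInter fun _ => ?_
      refine isClosed_le ?_ (by fun_prop)
      exact ((hF.comp (c1 s)).sub continuous_const).mul (continuous_enorm2.comp ((c1 t).sub (c1 s)))
    have h7 : IsClosed {Φ : ℝ → (ℝ × ℝ) × (ℝ × ℝ) | ∀ s t : ℝ, 0 ≤ s → s ≤ t → t ≤ 1 →
      |(Φ t).2.2 - (Φ s).2.2 - (Φ s).1.1 * ((Φ t).1.2 - (Φ s).1.2)| ≤ L ^ 2 * (t - s) ^ 2} := by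
      simp only [Set.ofPred_forall]
      refine isClosed_iInter fun s => isClosed_iInter fun t => isClosed_iInter fun _ => isClosed_iInter fun _ =>
        isClosed_iInter fun _ => ?_
      exact isClosed_le (by fun_prop) continuous_const
    refine (isClosed_setOfPred_lipschitzWith M).inter (hl2.inter (IsClosed.inter ?_ (IsClosed.inter ?_ (IsClosed.inter ?_ (IsClosed.inter ?_ ?_)))))
    · exact isClosed_eq (by fun_prop) continuous_const
    · exact isClosed_eq (by fun_prop) continuous_const
    · exact isClosed_eq (by fun_prop) continuous_const
    · exact h6
    · exact h7
  · intro Φ hΦ t _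
    have := hΦ.1.dist_le_mul t 0
    rw [hΦ.2.2.1] at this
    simpa [Real.dist_eq] using this

lemma goodSet_out {F : ℝ × ℝ → ℝ} (hF : Continuous F) {L M : ℝ≥0} {δ : ℝ → ℝ}
    (hδ : ∀ ε > 0, 0 < δ ε) {p q : ℝ × ℝ} {A : ℝ} {Φ : ℝ → (ℝ × ℝ) × (ℝ × ℝ)}
    (h : Φ ∈ goodSet F L M δ p q A) :
    sArea 0 1 (fun t => (Φ t).1) = A ∧ degLen F 0 1 (fun t => (Φ t).1) ≤ (Φ 1).2.1 := by
  obtain ⟨hM, hL, h0, h1, hA, he, ha⟩ := h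
  have h2 : LipschitzWith M (fun t => (Φ t).2) := by
    have := LipschitzWith.prod_snd.comp hM
    rw [one_mul] at this; exact this
  have hsl : ∀ t ∈ Ioo (0:ℝ) 1, ∀ᶠ v in 𝓝[>] t, t < v ∧ v ≤ 1 := fun t ht => by
    filter_upwards [Ioc_mem_nhdsGT ht.2] with v hv using hv
  constructor
  · have hal := lip_snd h2
    have := ftc_on zero_le_one (hal.lipschitzOnWith (s := Icc 0 1))
    simp only [hA, h0, sub_zero] at this
    rw [← this]
    refine int_congr_Ioo zero_le_one ?_
    filter_upwards [hal.ae_differentiableAt, (lip_snd hL).ae_differentiableAt] with t d1 d2 ht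
    have t1 := (hasDerivAt_iff_tendsto_slope.1 d1.hasDerivAt).mono_left (nhdsGT_le_nhdsNE t)
    have t2 := (hasDerivAt_iff_tendsto_slope.1 d2.hasDerivAt).mono_left (nhdsGT_le_nhdsNE t)
    have t3 := (t1.sub (t2.const_mul (Φ t).1.1)).abs
    have t4 : Tendsto (fun v => (L:ℝ) ^ 2 * (v - t)) (𝓝[>] t) (𝓝 0) := by
      have : Continuous (fun v => (L:ℝ) ^ 2 * (v - t)) := by fun_prop
      have := this.tendsto t
      simp only [sub_self, mul_zero] at this
      exact this.mono_left nhdsWithin_le_nhds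
    have := le_of_tendsto_of_tendsto t3 t4 (by
      filter_upwards [hsl t ht] with v hv
      have hvt : 0 < v - t := sub_pos.2 hv.1
      have := ha t v ht.1.le hv.1.le hv.2
      rw [slope_def_field, slope_def_field]
      rw [show ((Φ v).2.2 - (Φ t).2.2) / (v - t) - (Φ t).1.1 * (((Φ v).1.2 - (Φ t).1.2) / (v - t))
        = ((Φ v).2.2 - (Φ t).2.2 - (Φ t).1.1 * ((Φ v).1.2 - (Φ t).1.2)) / (v - t) by ring]
      rw [abs_div, abs_of_pos hvt, div_le_iff₀ hvt]
      linarith)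
    have := abs_eq_zero.1 (le_antisymm this (abs_nonneg _))
    linarith
  · have hel := lip_fst h2
    have := int_le_sub (g := fun t => F (Φ t).1 * enorm2 (deriv (fun t => (Φ t).1) t)) zero_le_one (hel.lipschitzOnWith (s := Icc 0 1)) (intg_eD hF hL 0 1) (by
      filter_upwards [hel.ae_differentiableAt, ae_diff hL] with t d1 d2 ht
      have t1 := (hasDerivAt_iff_tendsto_slope.1 d1.hasDerivAt).mono_left (nhdsGT_le_nhdsNE t)
      have t2 := (hasDerivAt_iff_tendsto_slope.1 d2.hasDerivAt).mono_left (nhdsGT_le_nhdsNE t)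
      have hε : ∀ ε > 0, (F (Φ t).1 - ε) * enorm2 (deriv (fun t => (Φ t).1) t) ≤ deriv (fun t => (Φ t).2.1) t := by
        intro ε hε
        refine le_of_tendsto_of_tendsto (((continuous_enorm2.tendsto _).comp t2).const_mul _) t1 ?_
        have hd : ∀ᶠ v in 𝓝[>] t, (L:ℝ) * (v - t) < δ ε := by
          have : Continuous (fun v => (L:ℝ) * (v - t)) := by fun_prop
          have := this.tendsto t
          simp only [sub_self, mul_zero] at this
          exact (this.mono_left nhdsWithin_le_nhds).eventually_lt_const (hδ ε hε)
        filter_upwards [hsl t ht, hd] with v hv hdv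
        have hvt : 0 < v - t := sub_pos.2 hv.1
        have := he t v ε hε ht.1.le hv.1.le hv.2 hdv
        simp only [Function.comp, slope_def_module, enorm2_smul, smul_eq_mul]
        rw [abs_of_pos (inv_pos.2 hvt), mul_left_comm]
        exact mul_le_mul_of_nonneg_left this (inv_pos.2 hvt).le
      have t5 : Tendsto (fun ε => (F (Φ t).1 - ε) * enorm2 (deriv (fun t => (Φ t).1) t)) (𝓝[>] 0) (𝓝 (F (Φ t).1 * enorm2 (deriv (fun t => (Φ t).1) t))) := by
        have : Continuous (fun ε => (F (Φ t).1 - ε) * enorm2 (deriv (fun t => (Φ t).1) t)) := by fun_prop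
        have := this.tendsto 0
        simp only [sub_zero] at this
        exact this.mono_left nhdsWithin_le_nhds
      exact le_of_tendsto t5 (by filter_upwards [self_mem_nhdsWithin] with ε h using hε ε h))
    simp only [h0, sub_zero] at this
    exact this

lemma goodSet_in {F : ℝ × ℝ → ℝ} (hF : Continuous F) (hF0 : ∀ x, 0 ≤ F x) (L : ℝ≥0) (p : ℝ × ℝ) :
    ∃ (M : ℝ≥0) (δ : ℝ → ℝ), (∀ ε > 0, 0 < δ ε) ∧ ∀ (q : ℝ × ℝ) (A : ℝ) (γ : ℝ → ℝ × ℝ), LipschitzWith L γ → γ 0 = p →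
      γ 1 = q → sArea 0 1 γ = A →
      ∃ Φ ∈ goodSet F L M δ p q A, (Φ 1).2.1 = degLen F 0 1 γ := by
  obtain ⟨MF, hMF⟩ := (isCompact_closedBall p (L:ℝ)).exists_bound_of_continuousOn hF.continuousOn
  have huc := (isCompact_closedBall p (L:ℝ)).uniformContinuousOn_of_continuous hF.continuousOn
  rw [Metric.uniformContinuousOn_iff] at huc
  have : ∀ ε : ℝ, ∃ d : ℝ, 0 < ε → 0 < d ∧ ∀ x ∈ Metric.closedBall p (L:ℝ), ∀ y ∈ Metric.closedBall p (L:ℝ), dist x y < d → dist (F x) (F y) < ε := by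
    intro ε
    by_cases h : 0 < ε
    · obtain ⟨d, hd, h2⟩ := huc ε h
      exact ⟨d, fun _ => ⟨hd, h2⟩⟩
    · exact ⟨0, fun h' => absurd h' h⟩
  choose δ hδ using this
  refine ⟨max L (max (MF * (2 * L)).toNNReal ((‖p‖ + L) * L).toNNReal), δ, fun ε hε => (hδ ε hε).1, ?_⟩
  intro q A γ hγ h0 h1 hA
  have hball : ∀ t ∈ Icc (0:ℝ) 1, γ t ∈ Metric.closedBall p (L:ℝ) := by
    intro t ht
    have := hγ.dist_le_mul t 0
    rw [h0, Real.dist_eq, sub_zero, abs_of_nonneg ht.1] at this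
    exact this.trans (mul_le_of_le_one_right L.2 ht.2)
  have he := prim_lip (d := fun t => F (γ t) * enorm2 (deriv γ t)) (M := MF * (2 * L)) zero_le_one (meas_eD hF hγ) (fun t ht => by
    have h3 := hMF _ (hball t ht)
    rw [abs_mul, abs_of_nonneg (enorm2_nonneg _)]
    exact mul_le_mul h3 ((enorm2_le _).trans (by linarith [deriv_bd hγ t])) (enorm2_nonneg _) ((norm_nonneg _).trans h3))
  have ha := prim_lip (d := fun t => (γ t).1 * deriv (fun s => (γ s).2) t) (M := (‖p‖ + L) * L) zero_le_one (meas_aD hγ) (fun t ht => by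
    have h3 : |(γ t).1| ≤ ‖p‖ + L := by
      have h4 : |(γ t).1| ≤ ‖γ t‖ := norm_fst_le (γ t)
      have h5 := norm_le_norm_add_norm_sub p (γ t)
      have h6 := hball t ht
      rw [mem_closedBall_iff_norm'] at h6
      linarith
    rw [abs_mul]
    exact mul_le_mul h3 (deriv2_bd hγ t) (abs_nonneg _) (by positivity))
  have hg : LipschitzWith L (fun t => γ (clampI t)) := by
    have := hγ.comp clampI_lip
    rw [mul_one] at this; exact this
  refine ⟨fun t => (γ (clampI t), (degLen F 0 (clampI t) γ, sArea 0 (clampI t) γ)), ⟨?_, hg, ?_, ?_, ?_, ?_, ?_⟩, ?_⟩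
  · exact hg.prodMk ((lip_clamp he).prodMk (lip_clamp ha))
  · simp [clampI_of_mem (left_mem_Icc.2 zero_le_one), h0, degLen, sArea]
  · simp [clampI_of_mem (right_mem_Icc.2 zero_le_one), h1]
  · simp [clampI_of_mem (right_mem_Icc.2 zero_le_one), hA]
  · intro s t ε hε hs hst ht hd
    have ms : s ∈ Icc (0:ℝ) 1 := ⟨hs, hst.trans ht⟩
    have mt : t ∈ Icc (0:ℝ) 1 := ⟨hs.trans hst, ht⟩
    simp only [clampI_of_mem ms, clampI_of_mem mt]
    rw [← degLen_add hF hγ 0 s t, add_sub_cancel_left]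
    rcases le_total (F (γ s) - ε) 0 with hn | hn
    · exact (mul_nonpos_of_nonpos_of_nonneg hn (enorm2_nonneg _)).trans (degLen_nonneg hF0 hst)
    calc _ ≤ (F (γ s) - ε) * ∫ u in s..t, enorm2 (deriv γ u) := by
          gcongr; exact enorm2_sub_le hγ hst
      _ = ∫ u in s..t, (F (γ s) - ε) * enorm2 (deriv γ u) := by
          rw [intervalIntegral.integral_const_mul]
      _ ≤ _ := by
          refine int_mono_Ioo hst ((intg_enorm2 hγ s t).const_mul _) (intg_eD hF hγ s t) (ae_of_all _ fun u hu => ?_)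
          refine mul_le_mul_of_nonneg_right ?_ (enorm2_nonneg _)
          have mu : u ∈ Icc (0:ℝ) 1 := ⟨hs.trans hu.1.le, hu.2.le.trans ht⟩
          have := (hδ ε hε).2 _ (hball s ms) _ (hball u mu) (by
            refine (hγ.dist_le_mul s u).trans_lt (lt_of_le_of_lt ?_ hd)
            rw [Real.dist_eq, abs_sub_comm, abs_of_pos (sub_pos.2 hu.1)]
            gcongr; exact hu.2.le)
          rw [Real.dist_eq] at this
          linarith [(abs_lt.1 this).2]
  · intro s t hs hst ht
    have ms : s ∈ Icc (0:ℝ) 1 := ⟨hs, hst.trans ht⟩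
    have mt : t ∈ Icc (0:ℝ) 1 := ⟨hs.trans hst, ht⟩
    simp only [clampI_of_mem ms, clampI_of_mem mt]
    rw [← sArea_add hγ 0 s t, add_sub_cancel_left]
    have hc := ftc_on hst ((lip_snd hγ).lipschitzOnWith (s := Icc s t))
    have hi : IntervalIntegrable (deriv fun s => (γ s).2) volume s t :=
      intg_of_bdd (measurable_deriv _) ⟨L, fun t _ => deriv2_bd hγ t⟩
    rw [← hc, ← intervalIntegral.integral_const_mul]
    unfold sArea
    rw [← intervalIntegral.integral_sub (intg_aD hγ s t) (hi.const_mul _)]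
    have := intervalIntegral.norm_integral_le_of_norm_le_const (a := s) (b := t) (C := (L:ℝ) ^ 2 * (t - s))
      (f := fun x => (γ x).1 * deriv (fun s => (γ s).2) x - (γ s).1 * deriv (fun s => (γ s).2) x) (by
      intro u hu
      rw [uIoc_of_le hst] at hu
      have h3 := (lip_fst hγ).dist_le_mul u s
      rw [Real.dist_eq, Real.dist_eq, abs_of_nonneg (by linarith [hu.1] : 0 ≤ u - s)] at h3
      rw [Real.norm_eq_abs, ← sub_mul, abs_mul]
      calc _ ≤ (L * (u - s)) * L := mul_le_mul h3 (deriv2_bd hγ u) (abs_nonneg _) (mul_nonneg L.2 (by linarith [hu.1]))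
        _ ≤ (L * (t - s)) * L := by gcongr; exact hu.2
        _ = _ := by ring)
    rw [abs_of_nonneg (sub_nonneg.2 hst)] at this
    calc _ ≤ _ := this
      _ = _ := by ring
  · simp [clampI_of_mem (right_mem_Icc.2 zero_le_one)]

lemma exists_min {F : ℝ × ℝ → ℝ} (hF : Continuous F) (hF0 : ∀ x, 0 ≤ F x) (L : ℝ≥0) (p q : ℝ × ℝ) (A : ℝ)
    (hne : ∃ γ, LipschitzWith L γ ∧ γ 0 = p ∧ γ 1 = q ∧ sArea 0 1 γ = A) :
    ∃ γ, (LipschitzWith L γ ∧ γ 0 = p ∧ γ 1 = q ∧ sArea 0 1 γ = A) ∧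
      ∀ γ', LipschitzWith L γ' → γ' 0 = p → γ' 1 = q → sArea 0 1 γ' = A →
        degLen F 0 1 γ ≤ degLen F 0 1 γ' := by
  obtain ⟨M, δ, hδ, hin⟩ := goodSet_in hF hF0 L p
  obtain ⟨γ1, a1, a2, a3, a4⟩ := hne
  obtain ⟨Φ1, hΦ1, _⟩ := hin q A γ1 a1 a2 a3 a4
  obtain ⟨Φ, hΦ, hmin⟩ := (goodSet_compact hF L M δ p q A).exists_isMinOn ⟨Φ1, hΦ1⟩
    (f := fun Φ => (Φ 1).2.1) (by fun_prop)
  obtain ⟨o1, o2⟩ := goodSet_out hF hδ hΦ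
  refine ⟨fun t => (Φ t).1, ⟨hΦ.2.1, by simp [hΦ.2.2.1], hΦ.2.2.2.1, o1⟩, ?_⟩
  intro γ' b1 b2 b3 b4
  obtain ⟨Φ', hΦ', h'⟩ := hin q A γ' b1 b2 b3 b4
  have := hmin hΦ'
  simp only at this
  exact o2.trans ((isMinOn_iff.1 hmin Φ' hΦ').trans h'.le)

end

section

lemma well_bounds {W : ℝ × ℝ → ℝ} {p : ℝ × ℝ} (hs : ContDiff ℝ (⊤ : ℕ∞) W) (h0 : ∀ x, 0 ≤ W x) (hp : W p = 0)
    (hh : ∀ v : ℝ × ℝ, v ≠ 0 → 0 < iteratedFDeriv ℝ 2 W p ![v, v]) :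
    ∃ ρ > 0, ∃ c > 0, ∃ C > 0, ∀ x, ‖x - p‖ ≤ ρ → c * ‖x - p‖ ≤ √(W x) ∧ √(W x) ≤ C * ‖x - p‖ := by
  have hdW : Differentiable ℝ W := hs.differentiable (by simp)
  have hDc : ContDiff ℝ 1 (fderiv ℝ W) := hs.fderiv_right (m := 1) (by norm_cast)
  have hD : Differentiable ℝ (fderiv ℝ W) := hDc.differentiable (by simp)
  have hDp : fderiv ℝ W p = 0 := by
    apply IsLocalMin.fderiv_eq_zero
    filter_upwards with x
    rw [hp]; exact h0 x
  set H := fderiv ℝ (fderiv ℝ W) p with hH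
  have hpos : ∀ v : ℝ × ℝ, v ≠ 0 → 0 < H v v := by
    intro v hv
    have := hh v hv
    rw [iteratedFDeriv_two_apply] at this
    simpa using this
  obtain ⟨κ, hκ, hκb⟩ : ∃ κ > 0, ∀ v : ℝ × ℝ, κ * ‖v‖ ^ 2 ≤ H v v := by
    have hcpt : IsCompact (Metric.sphere (0 : ℝ × ℝ) 1) := isCompact_sphere _ _
    have hne : (Metric.sphere (0 : ℝ × ℝ) 1).Nonempty := ⟨(1, 0), by simp⟩
    have hc : Continuous fun v : ℝ × ℝ => H v v := by fun_prop
    obtain ⟨v0, hv0, hm⟩ := hcpt.exists_isMinOn hne hc.continuousOn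
    have hv0' : v0 ≠ 0 := by
      rintro rfl; simp at hv0
    refine ⟨H v0 v0, hpos v0 hv0', fun v => ?_⟩
    by_cases hv : v = 0
    · simp [hv]
    have hn : 0 < ‖v‖ := norm_pos_iff.2 hv
    have hmem : ‖v‖⁻¹ • v ∈ Metric.sphere (0 : ℝ × ℝ) 1 := by
      simp [norm_smul, hn.ne']
    have := hm hmem
    simp only [mem_ofPred_eq, map_smul, _root_.smul_apply, smul_eq_mul] at this
    calc H v0 v0 * ‖v‖ ^ 2 ≤ (‖v‖⁻¹ * (‖v‖⁻¹ * H v v)) * ‖v‖ ^ 2 := by gcongr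
      _ = H v v := by field_simp
  have hfd : HasFDerivAt (fderiv ℝ W) H p := (hD p).hasFDerivAt
  have hev := hfd.isLittleO.def (half_pos hκ)
  obtain ⟨ρ, hρ, hball⟩ := Metric.eventually_nhds_iff_ball.1 hev
  refine ⟨ρ / 2, half_pos hρ, √(κ / 4), Real.sqrt_pos.2 (by positivity), √((‖H‖ + κ)/2), Real.sqrt_pos.2 (by positivity), fun x hx => ?_⟩
  set v := x - p with hv
  have hder : ∀ t : ℝ, HasDerivAt (fun t : ℝ => W (p + t • v)) (fderiv ℝ W (p + t • v) v) t := by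
    intro t
    have h1 : HasDerivAt (fun t : ℝ => p + t • v) v t := by
      simpa using ((hasDerivAt_id t).smul_const v).const_add p
    exact (hdW _).hasFDerivAt.comp_hasDerivAt t h1
  have hest : ∀ t ∈ Icc (0:ℝ) 1, |fderiv ℝ W (p + t • v) v - t * H v v| ≤ κ / 2 * t * ‖v‖ ^ 2 := by
    intro t ht
    have hmem : p + t • v ∈ Metric.ball p ρ := by
      simp only [Metric.mem_ball, dist_self_add_left, norm_smul, Real.norm_eq_abs, abs_of_nonneg ht.1]
      have : t * ‖v‖ ≤ 1 * ‖v‖ := by gcongr; exact ht.2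
      linarith
    have := hball _ hmem
    rw [hDp, sub_zero, add_sub_cancel_left] at this
    have h2 := (fderiv ℝ W (p + t • v) - H (t • v)).le_opNorm v
    simp only [map_smul, _root_.sub_apply, _root_.smul_apply, smul_eq_mul, Real.norm_eq_abs] at h2
    refine h2.trans ?_
    rw [map_smul] at this
    calc _ ≤ κ / 2 * ‖t • v‖ * ‖v‖ := by gcongr
      _ = _ := by rw [norm_smul, Real.norm_eq_abs, abs_of_nonneg ht.1]; ring
  have hHup : H v v ≤ ‖H‖ * ‖v‖ ^ 2 := by
    have := H.le_opNorm₂ v v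
    rw [Real.norm_eq_abs] at this
    calc _ ≤ _ := le_abs_self _
      _ ≤ _ := this
      _ = _ := by ring
  have hlo : κ / 4 * ‖v‖ ^ 2 ≤ W x := by
    have hmono : MonotoneOn (fun t : ℝ => W (p + t • v) - κ / 4 * ‖v‖ ^ 2 * t ^ 2) (Icc 0 1) := by
      have hd : ∀ t : ℝ, HasDerivAt (fun t : ℝ => W (p + t • v) - κ / 4 * ‖v‖ ^ 2 * t ^ 2)
          (fderiv ℝ W (p + t • v) v - κ / 4 * ‖v‖ ^ 2 * (2 * t)) t := fun t => by
        refine ((hder t).sub ((hasDerivAt_pow 2 t).const_mul (κ / 4 * ‖v‖ ^ 2))).congr_deriv ?_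
        norm_num
      refine monotoneOn_of_deriv_nonneg (convex_Icc 0 1) (fun t _ => (hd t).continuousAt.continuousWithinAt)
        (fun t _ => (hd t).differentiableAt.differentiableWithinAt) fun t ht => ?_
      rw [interior_Icc] at ht
      rw [(hd t).deriv]
      have := (abs_le.1 (hest t ⟨ht.1.le, ht.2.le⟩)).1
      have h3 := mul_le_mul_of_nonneg_left (hκb v) ht.1.le
      nlinarith
    have := hmono (left_mem_Icc.2 zero_le_one) (right_mem_Icc.2 zero_le_one) zero_le_one
    simp only [zero_smul, add_zero, hp, one_smul, hv, add_sub_cancel] at this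
    norm_num at this
    linarith
  have hup : W x ≤ (‖H‖ + κ) / 2 * ‖v‖ ^ 2 := by
    have hmono : MonotoneOn (fun t : ℝ => (‖H‖ + κ) / 2 * ‖v‖ ^ 2 * t ^ 2 - W (p + t • v)) (Icc 0 1) := by
      have hd : ∀ t : ℝ, HasDerivAt (fun t : ℝ => (‖H‖ + κ) / 2 * ‖v‖ ^ 2 * t ^ 2 - W (p + t • v))
          ((‖H‖ + κ) / 2 * ‖v‖ ^ 2 * (2 * t) - fderiv ℝ W (p + t • v) v) t := fun t => by
        refine (((hasDerivAt_pow 2 t).const_mul ((‖H‖ + κ) / 2 * ‖v‖ ^ 2)).sub (hder t)).congr_deriv ?_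
        norm_num
      refine monotoneOn_of_deriv_nonneg (convex_Icc 0 1) (fun t _ => (hd t).continuousAt.continuousWithinAt)
        (fun t _ => (hd t).differentiableAt.differentiableWithinAt) fun t ht => ?_
      rw [interior_Icc] at ht
      rw [(hd t).deriv]
      have := (abs_le.1 (hest t ⟨ht.1.le, ht.2.le⟩)).2
      have h3 := mul_le_mul_of_nonneg_left hHup ht.1.le
      have h4 : 0 ≤ κ / 2 * t * ‖v‖ ^ 2 := by have := ht.1.le; positivity
      nlinarith
    have := hmono (left_mem_Icc.2 zero_le_one) (right_mem_Icc.2 zero_le_one) zero_le_one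
    simp only [zero_smul, add_zero, hp, one_smul, hv, add_sub_cancel] at this
    norm_num at this
    linarith
  constructor
  · rw [← Real.sqrt_sq (norm_nonneg v), ← Real.sqrt_mul (by positivity)]
    exact Real.sqrt_le_sqrt hlo
  · rw [← Real.sqrt_sq (norm_nonneg v), ← Real.sqrt_mul (by positivity)]
    exact Real.sqrt_le_sqrt hup

lemma away_bound {W : ℝ × ℝ → ℝ} {pm pp : ℝ × ℝ} (hW : TwoWell W pm pp) {r : ℝ} (hr : 0 < r) :
    ∃ m > 0, ∀ x, r ≤ ‖x - pm‖ → r ≤ ‖x - pp‖ → m ≤ √(W x) := by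
  obtain ⟨c, hc, R, hR⟩ := hW.coercive
  have hcW : Continuous W := hW.smooth.continuous
  set S : Set (ℝ × ℝ) := Metric.closedBall 0 R ∩ {x | r ≤ ‖x - pm‖ ∧ r ≤ ‖x - pp‖} with hS
  have hc1 : IsClosed {x : ℝ × ℝ | r ≤ ‖x - pm‖} := isClosed_le continuous_const (by fun_prop)
  have hc2 : IsClosed {x : ℝ × ℝ | r ≤ ‖x - pp‖} := isClosed_le continuous_const (by fun_prop)
  have hcpt : IsCompact S := (isCompact_closedBall _ _).inter_right (hc1.inter hc2)
  have key : ∃ m > 0, ∀ x ∈ S, m ≤ W x := by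
    by_cases hne : S.Nonempty
    · obtain ⟨x0, hx0, hm⟩ := hcpt.exists_isMinOn hne hcW.continuousOn
      refine ⟨W x0, ?_, fun x hx => hm hx⟩
      refine lt_of_le_of_ne (hW.nonneg _) fun h => ?_
      rcases (hW.zeroSet x0).1 h.symm with h | h
      · have := hx0.2.1; rw [h] at this; simp at this; linarith
      · have := hx0.2.2; rw [h] at this; simp at this; linarith
    · exact ⟨1, one_pos, fun x hx => absurd ⟨x, hx⟩ hne⟩
  obtain ⟨m, hm, hmb⟩ := key
  refine ⟨√(min m c), Real.sqrt_pos.2 (lt_min hm hc), fun x h1 h2 => Real.sqrt_le_sqrt ?_⟩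
  by_cases hx : R ≤ ‖x‖
  · exact (min_le_right _ _).trans (hR x hx)
  · exact (min_le_left _ _).trans (hmb x ⟨by simpa using (not_le.1 hx).le, h1, h2⟩)

end

section

lemma degLen_mono {F : ℝ × ℝ → ℝ} {γ : ℝ → ℝ × ℝ} {K : ℝ≥0} (hF : Continuous F) (hF0 : ∀ p, 0 ≤ F p) (hγ : LipschitzWith K γ)
    {a b c d : ℝ} (hab : a ≤ b) (_ : b ≤ c) (hcd : c ≤ d) : degLen F b c γ ≤ degLen F a d γ := by
  have h1 := degLen_add hF hγ a b d
  have h2 := degLen_add hF hγ b c d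
  have h3 := degLen_nonneg (γ := γ) hF0 hab
  have h4 := degLen_nonneg (γ := γ) hF0 hcd
  linarith

lemma abs_min_sub (a b r : ℝ) : |min a r - min b r| ≤ |a - b| := by
  rcases min_cases a r with h | h <;> rcases min_cases b r with h' | h' <;> rw [h.1, h'.1, abs_le] <;>
    constructor <;> cases abs_cases (a - b) <;> linarith

lemma confine {F : ℝ × ℝ → ℝ} {γ : ℝ → ℝ × ℝ} {K : ℝ≥0} (hF : Continuous F) (hF0 : ∀ p, 0 ≤ F p) (hγ : LipschitzWith K γ)
    {p : ℝ × ℝ} {c ρ : ℝ} (hc : 0 < c) (hρ : 0 < ρ) (hw : ∀ x, ‖x - p‖ ≤ ρ → c * ‖x - p‖ ≤ F x)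
    {α β t : ℝ} (ht : t ∈ Icc α β) (h : γ α = p ∨ γ β = p) :
    c / 2 * (min ‖γ t - p‖ ρ) ^ 2 ≤ degLen F α β γ := by
  set φ : ℝ × ℝ → ℝ := fun x => c / 2 * (min ‖x - p‖ ρ) ^ 2 with hφ
  have hdif : ∀ x y, |φ y - φ x| ≤ c / 2 * (min ‖y - p‖ ρ + min ‖x - p‖ ρ) * ‖y - x‖ := by
    intro x y
    have e : φ y - φ x = c / 2 * (min ‖y - p‖ ρ + min ‖x - p‖ ρ) * (min ‖y - p‖ ρ - min ‖x - p‖ ρ) := by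
      simp only [hφ]; ring
    have h0 : 0 ≤ min ‖y - p‖ ρ + min ‖x - p‖ ρ := add_nonneg (le_min (norm_nonneg _) hρ.le) (le_min (norm_nonneg _) hρ.le)
    rw [e, abs_mul, abs_of_nonneg (by positivity)]
    gcongr
    refine (abs_min_sub _ _ _).trans ((abs_norm_sub_norm_le _ _).trans ?_)
    simp
  have hlip : LipschitzWith (⟨c * ρ, by positivity⟩ : ℝ≥0) φ := by
    refine LipschitzWith.of_dist_le_mul fun y x => ?_
    rw [Real.dist_eq, dist_eq_norm]
    refine (hdif x y).trans ?_
    show _ ≤ c * ρ * ‖y - x‖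
    refine mul_le_mul_of_nonneg_right ?_ (norm_nonneg _)
    have h1 := min_le_right ‖y - p‖ ρ
    have h2 := min_le_right ‖x - p‖ ρ
    nlinarith
  have hs : ∀ x, ∀ ε > 0, ∀ᶠ y in 𝓝 x, |φ y - φ x| ≤ (F x + ε) * ‖y - x‖ := by
    intro x ε hε
    by_cases hx : ‖x - p‖ ≤ ρ
    · have hev : ∀ᶠ y in 𝓝 x, ‖y - x‖ < ε / c := by
        have := Metric.ball_mem_nhds x (div_pos hε hc)
        filter_upwards [this] with y hy
        simpa [dist_eq_norm] using hy
      filter_upwards [hev] with y hy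
      refine (hdif x y).trans ?_
      gcongr
      have h1 : min ‖y - p‖ ρ ≤ ‖x - p‖ + ‖y - x‖ := (min_le_left _ _).trans (by
        calc ‖y - p‖ = ‖(x - p) + (y - x)‖ := by congr 1; abel
          _ ≤ _ := norm_add_le _ _)
      have h2 := min_le_left ‖x - p‖ ρ
      have h3 := hw x hx
      rw [lt_div_iff₀ hc] at hy
      nlinarith
    · push Not at hx
      have hev : ∀ᶠ y in 𝓝 x, ρ < ‖y - p‖ :=
        (by fun_prop : Continuous fun y : ℝ × ℝ => ‖y - p‖).continuousAt.eventually (lt_mem_nhds hx)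
      filter_upwards [hev] with y hy
      have : φ y - φ x = 0 := by
        simp only [hφ]; rw [min_eq_right hy.le, min_eq_right hx.le]; ring
      rw [this, abs_zero]
      have := hF0 x
      positivity
  have hp0 : φ p = 0 := by simp [hφ, hρ.le]
  have hpos : 0 ≤ φ (γ t) := by simp only [hφ]; positivity
  rcases h with h | h
  · have := slope_bound hF hF0 hγ hlip hs ht.1
    rw [h, hp0, sub_zero, abs_of_nonneg hpos] at this
    exact this.trans (degLen_mono hF hF0 hγ le_rfl ht.1 ht.2)
  · have := slope_bound hF hF0 hγ hlip hs ht.2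
    rw [h, hp0, zero_sub, abs_neg, abs_of_nonneg hpos] at this
    exact this.trans (degLen_mono hF hF0 hγ ht.1 ht.2 le_rfl)

lemma confine' {F : ℝ × ℝ → ℝ} {γ : ℝ → ℝ × ℝ} {K : ℝ≥0} (hF : Continuous F) (hF0 : ∀ p, 0 ≤ F p) (hγ : LipschitzWith K γ)
    {p : ℝ × ℝ} {c ρ : ℝ} (hc : 0 < c) (hρ : 0 < ρ) (hw : ∀ x, ‖x - p‖ ≤ ρ → c * ‖x - p‖ ≤ F x)
    {α β t : ℝ} (ht : t ∈ Icc α β) (h : γ α = p ∨ γ β = p) (hE : degLen F α β γ < c / 2 * ρ ^ 2) :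
    ‖γ t - p‖ ≤ ρ ∧ c / 2 * ‖γ t - p‖ ^ 2 ≤ degLen F α β γ := by
  have := confine hF hF0 hγ hc hρ hw ht h
  by_cases hh : ‖γ t - p‖ ≤ ρ
  · rw [min_eq_left hh] at this; exact ⟨hh, this⟩
  · rw [min_eq_right (not_le.1 hh).le] at this; linarith

lemma far_bound {F : ℝ × ℝ → ℝ} {γ : ℝ → ℝ × ℝ} {K : ℝ≥0} (hF : Continuous F) (hF0 : ∀ p, 0 ≤ F p) (hγ : LipschitzWith K γ)
    {m R : ℝ} (hm : 0 < m) (hw : ∀ x, R ≤ ‖x‖ → m ≤ F x)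
    {t : ℝ} (ht : t ∈ Icc (0:ℝ) 1) (h : ‖γ 0‖ ≤ R) :
    ‖γ t‖ ≤ R + degLen F 0 1 γ / m := by
  set φ : ℝ × ℝ → ℝ := fun x => m * max (‖x‖ - R) 0 with hφ
  have hdif : ∀ x y, |φ y - φ x| ≤ m * ‖y - x‖ := by
    intro x y
    have e : φ y - φ x = m * (max (‖y‖ - R) 0 - max (‖x‖ - R) 0) := by
      simp only [hφ]; ring
    rw [e, abs_mul, abs_of_pos hm]
    gcongr
    refine (abs_max_sub_max_le_abs _ _ _).trans ?_
    rw [sub_sub_sub_cancel_right]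
    exact abs_norm_sub_norm_le _ _
  have hlip : LipschitzWith (⟨m, hm.le⟩ : ℝ≥0) φ := by
    refine LipschitzWith.of_dist_le_mul fun y x => ?_
    rw [Real.dist_eq, dist_eq_norm]
    exact hdif x y
  have hs : ∀ x, ∀ ε > 0, ∀ᶠ y in 𝓝 x, |φ y - φ x| ≤ (F x + ε) * ‖y - x‖ := by
    intro x ε hε
    by_cases hx : R ≤ ‖x‖
    · filter_upwards with y
      refine (hdif x y).trans ?_
      gcongr
      have := hw x hx
      linarith
    · push Not at hx
      have hev : ∀ᶠ y : ℝ × ℝ in 𝓝 x, ‖y‖ < R :=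
        continuous_norm.continuousAt.eventually (gt_mem_nhds hx)
      filter_upwards [hev] with y hy
      have : φ y - φ x = 0 := by
        simp only [hφ]; rw [max_eq_right (by linarith), max_eq_right (by linarith)]; ring
      rw [this, abs_zero]
      have := hF0 x
      positivity
  have := slope_bound hF hF0 hγ hlip hs ht.1
  have h0 : φ (γ 0) = 0 := by simp only [hφ]; rw [max_eq_right (by linarith)]; ring
  rw [h0, sub_zero] at this
  have h1 := (le_abs_self _).trans (this.trans (degLen_mono hF hF0 hγ le_rfl ht.1 ht.2))
  have h2 : m * (‖γ t‖ - R) ≤ φ (γ t) := by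
    simp only [hφ]; gcongr; exact le_max_left _ _
  have : ‖γ t‖ - R ≤ degLen F 0 1 γ / m := by
    rw [le_div_iff₀ hm]; linarith
  linarith

end

section

lemma exists_bump : ∃ G h h' : ℝ → ℝ, ∃ M > 0, ContDiff ℝ 1 G ∧ ContDiff ℝ 1 h ∧ (∀ x, HasDerivAt G (h x) x) ∧
    (∀ x, HasDerivAt h (h' x) x) ∧ (∀ x, |h x| ≤ M) ∧ (∀ x, |h' x| ≤ M) ∧
    (∀ x, x ∉ Icc (1/3 : ℝ) (2/3) → h x = 0 ∧ h' x = 0) ∧ G 0 = 0 ∧ G 1 = 1 := by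
  set G : ℝ → ℝ := fun x => Real.smoothTransition (3 * x - 1) with hG
  have hGs : ContDiff ℝ 3 G := Real.smoothTransition.contDiff.comp (by fun_prop)
  have hh : ContDiff ℝ 2 (deriv G) := ((contDiff_succ_iff_deriv (n := 2)).1 hGs).2.2
  have hh' : ContDiff ℝ 1 (deriv (deriv G)) := ((contDiff_succ_iff_deriv (n := 1)).1 hh).2.2
  have hz : ∀ x, x ∉ Icc (1/3 : ℝ) (2/3) → deriv G x = 0 := by
    intro x hx
    rw [mem_Icc, not_and_or, not_le, not_le] at hx
    rcases hx with hx | hx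
    · have : G =ᶠ[𝓝 x] fun _ => 0 := by
        filter_upwards [gt_mem_nhds hx] with y hy
        exact Real.smoothTransition.zero_of_nonpos (by linarith)
      rw [this.deriv_eq]; simp
    · have : G =ᶠ[𝓝 x] fun _ => 1 := by
        filter_upwards [lt_mem_nhds hx] with y hy
        exact Real.smoothTransition.one_of_one_le (by linarith)
      rw [this.deriv_eq]; simp
  have hz' : ∀ x, x ∉ Icc (1/3 : ℝ) (2/3) → deriv (deriv G) x = 0 := by
    intro x hx
    have : deriv G =ᶠ[𝓝 x] fun _ => 0 := by
      filter_upwards [isClosed_Icc.isOpen_compl.mem_nhds hx] with y hy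
      exact hz y hy
    rw [this.deriv_eq]; simp
  obtain ⟨M1, hM1⟩ := isCompact_Icc.exists_bound_of_continuousOn (s := Icc (1/3:ℝ) (2/3)) hh.continuous.continuousOn
  obtain ⟨M2, hM2⟩ := isCompact_Icc.exists_bound_of_continuousOn (s := Icc (1/3:ℝ) (2/3)) hh'.continuous.continuousOn
  refine ⟨G, deriv G, deriv (deriv G), max 1 (max M1 M2), by positivity, hGs.of_le (by norm_num), hh.of_le (by norm_num),
    fun x => (hGs.differentiable (by norm_num) x).hasDerivAt,
    fun x => (hh.differentiable (by norm_num) x).hasDerivAt, fun x => ?_, fun x => ?_, fun x hx => ⟨hz x hx, hz' x hx⟩, ?_, ?_⟩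
  · by_cases hx : x ∈ Icc (1/3:ℝ) (2/3)
    · exact (hM1 x hx).trans ((le_max_left _ _).trans (le_max_right _ _))
    · rw [hz x hx, abs_zero]; positivity
  · by_cases hx : x ∈ Icc (1/3:ℝ) (2/3)
    · exact (hM2 x hx).trans ((le_max_right _ _).trans (le_max_right _ _))
    · rw [hz' x hx, abs_zero]; positivity
  · exact Real.smoothTransition.zero_of_nonpos (by norm_num)
  · exact Real.smoothTransition.one_of_one_le (by norm_num)

lemma taylor2 {W : ℝ × ℝ → ℝ} (hs : ContDiff ℝ (⊤ : ℕ∞) W) (R : ℝ) :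
    ∃ C ≥ 0, ∀ x y, ‖x‖ ≤ R → ‖y‖ ≤ R → |W y - W x - fderiv ℝ W x (y - x)| ≤ C * ‖y - x‖ ^ 2 := by
  have hD : ContDiff ℝ 1 (fderiv ℝ W) := hs.fderiv_right (m := 1) (by norm_cast)
  have hdW : Differentiable ℝ W := hs.differentiable (by simp)
  obtain ⟨K, hK⟩ := hD.locallyLipschitz.locallyLipschitzOn.exists_lipschitzOnWith_of_compact (isCompact_closedBall (0 : ℝ × ℝ) R)
  refine ⟨K, K.2, fun x y hx hy => ?_⟩
  have hx' : x ∈ Metric.closedBall (0 : ℝ × ℝ) R := by simpa using hx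
  have hy' : y ∈ Metric.closedBall (0 : ℝ × ℝ) R := by simpa using hy
  have := (convex_segment x y).norm_image_sub_le_of_norm_hasFDerivWithin_le' (f := W) (f' := fderiv ℝ W) (φ := fderiv ℝ W x)
    (C := K * ‖y - x‖) (fun z _ => (hdW z).hasFDerivAt.hasFDerivWithinAt) (fun z hz => ?_) (left_mem_segment ℝ x y) (right_mem_segment ℝ x y)
  · rw [Real.norm_eq_abs] at this
    refine this.trans (le_of_eq (by ring))
  · have hz' := (convex_closedBall (0 : ℝ × ℝ) R).segment_subset hx' hy' hz
    have h1 := hK.dist_le_mul z hz' x hx'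
    rw [dist_eq_norm, dist_eq_norm] at h1
    refine h1.trans ?_
    gcongr
    exact norm_sub_le_of_mem_segment hz

lemma real_est {s w D r V B Q D0 W0 C1 c1 : ℝ} (hs : |s| ≤ 1) (hD : |D| ≤ D0) (hw : 0 ≤ w) (hw' : w ≤ W0)
    (hr : |r| ≤ C1 * s ^ 2) (hV : 0 ≤ V) (hB : |B| ≤ c1 * V) (hQ : 0 ≤ Q) (hQ' : Q ≤ c1 * V) (hC1 : 0 ≤ C1) (hc1 : 0 ≤ c1) :
    (w + s * D + r) * (V + 2 * (s * B) + s ^ 2 * Q) ≤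
      w * V + s * (D * V + 2 * (w * B)) + (C1 * (1 + 3 * c1) + W0 * c1 + 3 * D0 * c1) * s ^ 2 * V := by
  have hs2 : s ^ 2 ≤ 1 := by rw [← sq_abs]; nlinarith [abs_nonneg s]
  have hD0 : 0 ≤ D0 := (abs_nonneg _).trans hD
  have hsB : |s * B| ≤ c1 * V := by
    rw [abs_mul]; calc _ ≤ 1 * |B| := by gcongr
      _ ≤ _ := by rw [one_mul]; exact hB
  have hsQ : |s ^ 2 * Q| ≤ c1 * V := by
    rw [abs_mul, abs_of_nonneg (sq_nonneg s), abs_of_nonneg hQ]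
    calc _ ≤ 1 * Q := by gcongr
      _ ≤ _ := by rw [one_mul]; exact hQ'
  have hsQ1 : |s * Q| ≤ c1 * V := by
    rw [abs_mul, abs_of_nonneg hQ]
    calc _ ≤ 1 * Q := by gcongr
      _ ≤ _ := by rw [one_mul]; exact hQ'
  have e1 : r * (V + 2 * (s * B) + s ^ 2 * Q) ≤ C1 * s ^ 2 * (V + 3 * (c1 * V)) := by
    refine (le_abs_self _).trans ?_
    rw [abs_mul]
    have h : |V + 2 * (s * B) + s ^ 2 * Q| ≤ V + 3 * (c1 * V) := by
      rw [abs_le] at *; constructor <;> linarith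
    gcongr
  have e2 : w * (s ^ 2 * Q) ≤ W0 * (s ^ 2 * (c1 * V)) := by gcongr; exact hw.trans hw'
  have e3 : s ^ 2 * (D * (2 * B + s * Q)) ≤ s ^ 2 * (D0 * (3 * (c1 * V))) := by
    refine mul_le_mul_of_nonneg_left ?_ (sq_nonneg s)
    refine (le_abs_self _).trans ?_
    rw [abs_mul]
    have h : |2 * B + s * Q| ≤ 3 * (c1 * V) := by
      rw [abs_le] at *; constructor <;> linarith
    gcongr
  nlinarith

lemma sqrt_tangent {P Q : ℝ} (hP : 0 < P) (hQ : 0 ≤ Q) : √Q ≤ √P + (Q - P) / (2 * √P) := by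
  have hp := Real.sqrt_pos.2 hP
  have h1 := Real.sq_sqrt hP.le
  have h2 := Real.sq_sqrt hQ
  have : √P + (Q - P) / (2 * √P) - √Q = (√P - √Q) ^ 2 / (2 * √P) := by
    field_simp
    nlinarith
  have h3 : 0 ≤ (√P - √Q) ^ 2 / (2 * √P) := by positivity
  linarith

end

section

def thta (a b : ℝ) (p x : ℝ × ℝ) : ℝ := b * (x.1 - p.1) + a * (x.2 - p.2)

def shr (a b : ℝ) (p : ℝ × ℝ) (h : ℝ → ℝ) (s : ℝ) (x : ℝ × ℝ) : ℝ × ℝ :=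
  (x.1 - s * a * h (thta a b p x), x.2 + s * b * h (thta a b p x))

def dshr (a b : ℝ) (p : ℝ × ℝ) (h' : ℝ → ℝ) (s : ℝ) (x v : ℝ × ℝ) : ℝ × ℝ :=
  (v.1 - s * a * (h' (thta a b p x) * (b * v.1 + a * v.2)), v.2 + s * b * (h' (thta a b p x) * (b * v.1 + a * v.2)))

lemma cs2 (a b x y : ℝ) : (b * x + a * y) ^ 2 ≤ (a ^ 2 + b ^ 2) * (x ^ 2 + y ^ 2) := by
  nlinarith [sq_nonneg (b * y - a * x)]

lemma absB (a b x y μ : ℝ) : |μ * (-a * x + b * y)| ≤ (x ^ 2 + y ^ 2) + μ ^ 2 * (a ^ 2 + b ^ 2) := by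
  rw [abs_le]
  constructor
  · nlinarith [sq_nonneg (x - μ * a), sq_nonneg (y + μ * b), sq_nonneg (x + μ * a), sq_nonneg (y - μ * b)]
  · nlinarith [sq_nonneg (x - μ * a), sq_nonneg (y + μ * b), sq_nonneg (x + μ * a), sq_nonneg (y - μ * b)]

set_option maxHeartbeats 1000000 in
lemma pw_bound {W : ℝ × ℝ → ℝ} (hs : ContDiff ℝ (⊤ : ℕ∞) W) (h0 : ∀ x, 0 ≤ W x) {a b M m : ℝ} {p : ℝ × ℝ} {h h' : ℝ → ℝ}
    (hM : 0 < M) (hm : 0 < m) (hh : ∀ x, |h x| ≤ M) (hh' : ∀ x, |h' x| ≤ M)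
    (hz : ∀ x, x ∉ Icc (1/3 : ℝ) (2/3) → h x = 0 ∧ h' x = 0)
    (hst : ∀ x, thta a b p x ∈ Icc (1/3:ℝ) (2/3) → m ≤ √(W x)) (R : ℝ) :
    ∃ C > 0, ∀ x v : ℝ × ℝ, ‖x‖ ≤ R → ∃ Λ : ℝ, ∀ s : ℝ, |s| ≤ 1 →
      √(W (shr a b p h s x)) * enorm2 (dshr a b p h' s x v) ≤
        √(W x) * enorm2 v + s * Λ + C * s ^ 2 * (√(W x) * enorm2 v) ∧
      ‖dshr a b p h' s x v‖ ≤ ‖v‖ + |s| * C * (√(W x) * enorm2 v) := by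
  have hdW : Continuous (fderiv ℝ W) := (hs.fderiv_right (m := 1) (by norm_cast)).continuous
  set R' := R + M * ‖((-a, b) : ℝ × ℝ)‖ with hR'
  obtain ⟨C0, hC0, hT⟩ := taylor2 hs R'
  obtain ⟨D1, hD1⟩ := (isCompact_closedBall (0 : ℝ × ℝ) R).exists_bound_of_continuousOn hdW.continuousOn
  obtain ⟨W0, hW0⟩ := (isCompact_closedBall (0 : ℝ × ℝ) R).exists_bound_of_continuousOn hs.continuous.continuousOn
  set ne := ‖((-a, b) : ℝ × ℝ)‖ with hne
  set n := a ^ 2 + b ^ 2 with hn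
  have hn0 : 0 ≤ n := by positivity
  set c1 := 1 + M ^ 2 * n ^ 2 with hc1
  set D0 := |D1| * (M * ne) with hD0
  set C1 := C0 * (M * ne) ^ 2 with hC1
  set C2 := C1 * (1 + 3 * c1) + |W0| * c1 + 3 * D0 * c1 with hC2
  have hne0 : 0 ≤ ne := norm_nonneg _
  have hc10 : 0 ≤ c1 := by positivity
  have hC10 : 0 ≤ C1 := by positivity
  have hC20 : 0 ≤ C2 := by positivity
  set la := |b| + |a| with hla
  refine ⟨C2 / (2 * m ^ 2) + ne * M * la / m + 1, by positivity, fun x v hx => ?_⟩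
  set H := h (thta a b p x) with hH
  set H' := h' (thta a b p x) with hH'
  have hE0 : 0 ≤ √(W x) * enorm2 v := mul_nonneg (Real.sqrt_nonneg _) (enorm2_nonneg _)
  set μ := H' * (b * v.1 + a * v.2) with hμ
  have eshr : ∀ s, shr a b p h s x = x + (s * H) • ((-a, b) : ℝ × ℝ) := by
    intro s; ext <;> simp [shr, hH] <;> ring
  have edshr : ∀ s, dshr a b p h' s x v = v + (s * μ) • ((-a, b) : ℝ × ℝ) := by
    intro s; ext <;> simp [dshr, hμ, hH'] <;> ring
  by_cases hθ : thta a b p x ∈ Icc (1/3:ℝ) (2/3)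
  swap
  · have hH0 : H = 0 := (hz _ hθ).1
    have hH0' : H' = 0 := (hz _ hθ).2
    have hμ0 : μ = 0 := by rw [hμ, hH0']; ring
    refine ⟨0, fun s _ => ?_⟩
    rw [eshr, edshr, hH0, hμ0]
    simp only [mul_zero, zero_smul, add_zero]
    constructor
    · have : 0 ≤ (C2 / (2 * m ^ 2) + ne * M * la / m + 1) * s ^ 2 * (√(W x) * enorm2 v) := by positivity
      linarith
    · have : 0 ≤ |s| * (C2 / (2 * m ^ 2) + ne * M * la / m + 1) * (√(W x) * enorm2 v) := by positivity
      linarith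
  have hmF := hst x hθ
  have hnv : ‖v‖ ≤ √(W x) * enorm2 v / m := by
    rw [le_div_iff₀ hm]
    calc ‖v‖ * m ≤ enorm2 v * √(W x) := by gcongr; exacts [enorm2_nonneg v, norm_le_enorm2 v]
      _ = _ := by ring
  have hlam : |b * v.1 + a * v.2| ≤ la * ‖v‖ := by
    have h1 : |v.1| ≤ ‖v‖ := norm_fst_le v
    have h2 : |v.2| ≤ ‖v‖ := norm_snd_le v
    calc _ ≤ |b * v.1| + |a * v.2| := abs_add_le _ _
      _ = |b| * |v.1| + |a| * |v.2| := by rw [abs_mul, abs_mul]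
      _ ≤ |b| * ‖v‖ + |a| * ‖v‖ := by gcongr
      _ = _ := by ring
  have hμb : |μ| ≤ M * (la * ‖v‖) := by
    rw [hμ, abs_mul]; gcongr; exact hh' _
  have hnorm : ∀ s : ℝ, ‖dshr a b p h' s x v‖ ≤ ‖v‖ + |s| * (C2 / (2 * m ^ 2) + ne * M * la / m + 1) * (√(W x) * enorm2 v) := by
    intro s
    rw [edshr]
    refine (norm_add_le _ _).trans ?_
    rw [norm_smul, Real.norm_eq_abs, abs_mul, ← hne]
    have h1 : |s| * |μ| * ne ≤ |s| * (M * (la * (√(W x) * enorm2 v / m))) * ne := by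
      have : |μ| ≤ M * (la * (√(W x) * enorm2 v / m)) := hμb.trans (by gcongr)
      gcongr
    have h2 : |s| * (M * (la * (√(W x) * enorm2 v / m))) * ne = |s| * (ne * M * la / m) * (√(W x) * enorm2 v) := by
      field_simp
    have h3 : |s| * (ne * M * la / m) * (√(W x) * enorm2 v) ≤ |s| * (C2 / (2 * m ^ 2) + ne * M * la / m + 1) * (√(W x) * enorm2 v) := by
      gcongr
      have : 0 ≤ C2 / (2 * m ^ 2) := by positivity
      linarith
    linarith
  set V := v.1 ^ 2 + v.2 ^ 2 with hV
  have hV0 : 0 ≤ V := by positivity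
  have heV : enorm2 v = √V := rfl
  set D := fderiv ℝ W x (H • ((-a, b) : ℝ × ℝ)) with hD
  set B := μ * (-a * v.1 + b * v.2) with hB
  set Q := μ ^ 2 * n with hQ
  have hμ2 : μ ^ 2 ≤ M ^ 2 * (n * V) := by
    have h1 : (b * v.1 + a * v.2) ^ 2 ≤ n * V := cs2 a b v.1 v.2
    have h2 : H' ^ 2 ≤ M ^ 2 := by rw [← sq_abs H']; gcongr; exact hh' _
    rw [hμ, mul_pow]; gcongr
  have hQ0 : 0 ≤ Q := by positivity
  have hQV : Q ≤ M ^ 2 * n ^ 2 * V := by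
    calc Q ≤ M ^ 2 * (n * V) * n := by rw [hQ]; gcongr
      _ = _ := by ring
  have hQc : Q ≤ c1 * V := by rw [hc1]; linarith
  have hBc : |B| ≤ c1 * V := by
    have h1 : |B| ≤ V + Q := absB a b v.1 v.2 μ
    rw [hc1]; linarith
  have hxm : x ∈ Metric.closedBall (0 : ℝ × ℝ) R := by simpa using hx
  have hHe : ‖H • ((-a, b) : ℝ × ℝ)‖ ≤ M * ne := by
    rw [norm_smul]; gcongr; exact hh _
  have hDb : |D| ≤ D0 := by
    calc _ ≤ ‖fderiv ℝ W x‖ * ‖H • ((-a, b) : ℝ × ℝ)‖ := (fderiv ℝ W x).le_opNorm _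
      _ ≤ |D1| * (M * ne) := by gcongr; exact (hD1 x hxm).trans (le_abs_self _)
  have hWx : W x ≤ |W0| := (le_abs_self _).trans ((hW0 x hxm).trans (le_abs_self _))
  have hWp : 0 < W x := Real.sqrt_pos.1 (hm.trans_le hmF)
  have hm2 : m ^ 2 ≤ W x := by
    calc m ^ 2 ≤ √(W x) ^ 2 := by gcongr
      _ = W x := Real.sq_sqrt (h0 x)
  refine ⟨(D * V + 2 * (W x * B)) / (2 * (√(W x) * enorm2 v)), fun s hs1 => ⟨?_, hnorm s⟩⟩
  have hr : |W (shr a b p h s x) - W x - s * D| ≤ C1 * s ^ 2 := by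
    have hsm : ‖(s * H) • ((-a, b) : ℝ × ℝ)‖ ≤ |s| * (M * ne) := by
      rw [mul_smul, norm_smul, Real.norm_eq_abs]; gcongr
    have hsm' : ‖(s * H) • ((-a, b) : ℝ × ℝ)‖ ≤ M * ne := hsm.trans (by
      calc _ ≤ 1 * (M * ne) := by gcongr
        _ = _ := one_mul _)
    have := hT x (shr a b p h s x) (by rw [hR']; have : 0 ≤ M * ne := by positivity
                                       linarith) (by
      rw [eshr]; refine (norm_add_le _ _).trans ?_
      rw [hR']; linarith)
    rw [eshr, add_sub_cancel_left] at this
    rw [eshr]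
    have e2 : fderiv ℝ W x ((s * H) • ((-a, b) : ℝ × ℝ)) = s * D := by
      rw [hD, mul_smul, map_smul, smul_eq_mul]
    rw [e2] at this
    refine this.trans ?_
    calc _ ≤ C0 * (|s| * (M * ne)) ^ 2 := by gcongr
      _ = _ := by rw [mul_pow, sq_abs, hC1]; ring
  have hest := real_est hs1 hDb hWp.le hWx hr hV0 hBc hQ0 hQc hC10 hc10
  have hedv : enorm2 (dshr a b p h' s x v) = √(V + 2 * (s * B) + s ^ 2 * Q) := by
    rw [edshr, enorm2]; congr 1
    simp only [Prod.fst_add, Prod.snd_add, Prod.smul_fst, Prod.smul_snd, smul_eq_mul, hV, hB, hQ, hn]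
    ring
  by_cases hVz : V = 0
  · have hμz : μ = 0 := by
      have : μ ^ 2 ≤ 0 := by rw [hVz] at hμ2; simpa using hμ2
      exact pow_eq_zero_iff (two_ne_zero) |>.1 (le_antisymm this (sq_nonneg _))
    have : V + 2 * (s * B) + s ^ 2 * Q = 0 := by rw [hVz, hB, hQ, hμz]; ring
    rw [hedv, this, heV, hVz]; simp
  have hVp : 0 < V := lt_of_le_of_ne hV0 (Ne.symm hVz)
  set P0 := W x * V with hP0
  have hP0p : 0 < P0 := by positivity
  have hk0 : √(W x) * enorm2 v = √P0 := by rw [heV, ← Real.sqrt_mul (h0 x)]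
  have hks : √(W (shr a b p h s x)) * enorm2 (dshr a b p h' s x v) = √(W (shr a b p h s x) * (V + 2 * (s * B) + s ^ 2 * Q)) := by
    rw [hedv, ← Real.sqrt_mul (h0 _)]
  have hVV : 0 ≤ V + 2 * (s * B) + s ^ 2 * Q := by
    have : V + 2 * (s * B) + s ^ 2 * Q = (v.1 + s * μ * -a) ^ 2 + (v.2 + s * μ * b) ^ 2 := by
      simp only [hV, hB, hQ, hn]; ring
    rw [this]; positivity
  have htan := sqrt_tangent hP0p (mul_nonneg (h0 (shr a b p h s x)) hVV)
  have hsp : 0 < √P0 := Real.sqrt_pos.2 hP0p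
  rw [hks, hk0]
  refine htan.trans ?_
  have e3 : W x + s * D + (W (shr a b p h s x) - W x - s * D) = W (shr a b p h s x) := by ring
  rw [e3] at hest
  have e4 : (W (shr a b p h s x) * (V + 2 * (s * B) + s ^ 2 * Q) - P0) / (2 * √P0) ≤
      (s * (D * V + 2 * (W x * B)) + C2 * s ^ 2 * V) / (2 * √P0) := by
    gcongr
    linarith
  have e5 : C2 * s ^ 2 * V / (2 * √P0) ≤ C2 / (2 * m ^ 2) * s ^ 2 * √P0 := by
    rw [div_le_iff₀ (by positivity)]
    have : √P0 * √P0 = P0 := Real.mul_self_sqrt hP0p.le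
    have e6 : C2 / (2 * m ^ 2) * s ^ 2 * √P0 * (2 * √P0) = C2 * s ^ 2 * (P0 / m ^ 2) := by
      calc _ = C2 / (m ^ 2) * s ^ 2 * (√P0 * √P0) := by field_simp
        _ = _ := by rw [this]; ring
    rw [e6]
    gcongr
    rw [le_div_iff₀ (by positivity), hP0]
    calc V * m ^ 2 ≤ V * W x := by gcongr
      _ = _ := mul_comm _ _
  have e7 : C2 / (2 * m ^ 2) * s ^ 2 * √P0 ≤ (C2 / (2 * m ^ 2) + ne * M * la / m + 1) * s ^ 2 * √P0 := by
    gcongr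
    have : 0 ≤ ne * M * la / m := by positivity
    linarith
  have e8 : (s * (D * V + 2 * (W x * B)) + C2 * s ^ 2 * V) / (2 * √P0) = s * ((D * V + 2 * (W x * B)) / (2 * √P0)) + C2 * s ^ 2 * V / (2 * √P0) := by
    ring
  linarith

end

section

lemma thta_sub_le (a b : ℝ) (p x y : ℝ × ℝ) : |thta a b p x - thta a b p y| ≤ (|b| + |a|) * ‖x - y‖ := by
  have h1 : |x.1 - y.1| ≤ ‖x - y‖ := norm_fst_le (x - y)
  have h2 : |x.2 - y.2| ≤ ‖x - y‖ := norm_snd_le (x - y)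
  have e : thta a b p x - thta a b p y = b * (x.1 - y.1) + a * (x.2 - y.2) := by simp only [thta]; ring
  rw [e]
  calc _ ≤ |b * (x.1 - y.1)| + |a * (x.2 - y.2)| := abs_add_le _ _
    _ = |b| * |x.1 - y.1| + |a| * |x.2 - y.2| := by rw [abs_mul, abs_mul]
    _ ≤ |b| * ‖x - y‖ + |a| * ‖x - y‖ := by gcongr
    _ = _ := by ring

lemma shr_lip {γ : ℝ → ℝ × ℝ} {K : ℝ≥0} (hγ : LipschitzWith K γ) {a b M : ℝ} {p : ℝ × ℝ} {h h' : ℝ → ℝ} (hM : 0 < M)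
    (hd : ∀ x, HasDerivAt h (h' x) x) (hh' : ∀ x, |h' x| ≤ M) (s : ℝ) :
    ∃ K', LipschitzWith K' (fun t => shr a b p h s (γ t)) := by
  have hl : ∀ x y, |h x - h y| ≤ M * |x - y| := by
    intro x y
    have := convex_univ.norm_image_sub_le_of_norm_hasDerivWithin_le (f := h) (f' := h') (C := M)
      (fun x _ => (hd x).hasDerivWithinAt) (fun x _ => hh' x) (mem_univ y) (mem_univ x)
    simpa using this
  set N := ‖((-a, b) : ℝ × ℝ)‖
  refine ⟨⟨(1 + |s| * (M * (|b| + |a|)) * N) * K, by positivity⟩, LipschitzWith.of_dist_le_mul fun t t' => ?_⟩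
  have e : ∀ x, shr a b p h s x = x + (s * h (thta a b p x)) • ((-a, b) : ℝ × ℝ) := by
    intro x; ext <;> simp [shr] <;> ring
  have h1 := hγ.dist_le_mul t t'
  rw [dist_eq_norm] at h1
  rw [dist_eq_norm, e, e]
  have e2 : γ t + (s * h (thta a b p (γ t))) • ((-a, b) : ℝ × ℝ) - (γ t' + (s * h (thta a b p (γ t'))) • ((-a, b) : ℝ × ℝ)) =
    (γ t - γ t') + (s * (h (thta a b p (γ t)) - h (thta a b p (γ t')))) • ((-a, b) : ℝ × ℝ) := by
    rw [mul_sub, sub_smul]; abel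
  rw [e2]
  refine (norm_add_le _ _).trans ?_
  rw [norm_smul, Real.norm_eq_abs, abs_mul]
  have h2 : |h (thta a b p (γ t)) - h (thta a b p (γ t'))| ≤ M * ((|b| + |a|) * ‖γ t - γ t'‖) :=
    (hl _ _).trans (by gcongr; exact thta_sub_le _ _ _ _ _)
  calc ‖γ t - γ t'‖ + |s| * |h (thta a b p (γ t)) - h (thta a b p (γ t'))| * N
      ≤ ‖γ t - γ t'‖ + |s| * (M * ((|b| + |a|) * ‖γ t - γ t'‖)) * N := by gcongr
    _ = (1 + |s| * (M * (|b| + |a|)) * N) * ‖γ t - γ t'‖ := by ring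
    _ ≤ (1 + |s| * (M * (|b| + |a|)) * N) * (K * dist t t') := by gcongr
    _ = (1 + |s| * (M * (|b| + |a|)) * N) * K * dist t t' := by ring

lemma thta_deriv {γ : ℝ → ℝ × ℝ} {a b : ℝ} {p : ℝ × ℝ} {t : ℝ} (ht : DifferentiableAt ℝ γ t) :
    HasDerivAt (fun t => thta a b p (γ t)) (b * (deriv γ t).1 + a * (deriv γ t).2) t ∧
    HasDerivAt (fun t => (γ t).1) (deriv γ t).1 t ∧ HasDerivAt (fun t => (γ t).2) (deriv γ t).2 t := by
  have h := ht.hasDerivAt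
  have h1 : HasDerivAt (fun t => (γ t).1) (deriv γ t).1 t := h.fst
  have h2 : HasDerivAt (fun t => (γ t).2) (deriv γ t).2 t := h.snd
  exact ⟨((h1.sub_const p.1).const_mul b).add ((h2.sub_const p.2).const_mul a), h1, h2⟩

lemma shr_deriv {γ : ℝ → ℝ × ℝ} {a b : ℝ} {p : ℝ × ℝ} {h h' : ℝ → ℝ}
    (hd : ∀ x, HasDerivAt h (h' x) x) (s : ℝ) {t : ℝ} (ht : DifferentiableAt ℝ γ t) :
    HasDerivAt (fun t => shr a b p h s (γ t)) (dshr a b p h' s (γ t) (deriv γ t)) t := by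
  obtain ⟨h0, h1, h2⟩ := thta_deriv (a := a) (b := b) (p := p) ht
  have h3 := (hd (thta a b p (γ t))).comp t h0
  exact (h1.sub (h3.const_mul (s * a))).prodMk (h2.add (h3.const_mul (s * b)))

lemma shr_area {γ : ℝ → ℝ × ℝ} {K : ℝ≥0} (hγ : LipschitzWith K γ) {a b M : ℝ} {p : ℝ × ℝ} {G h h' : ℝ → ℝ} (hM : 0 < M)
    (hG1 : ContDiff ℝ 1 G) (hh1 : ContDiff ℝ 1 h) (hdG : ∀ x, HasDerivAt G (h x) x)
    (hd : ∀ x, HasDerivAt h (h' x) x) (hh' : ∀ x, |h' x| ≤ M) (s : ℝ)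
    (hG0 : G 0 = 0) (hG1' : G 1 = 1) (hh0 : h 0 = 0) (hh1' : h 1 = 0)
    (hθ0 : thta a b p (γ 0) = 0) (hθ1 : thta a b p (γ 1) = 1) :
    sArea 0 1 (fun t => shr a b p h s (γ t)) = sArea 0 1 γ - s := by
  set q : ℝ × ℝ → ℝ := fun x => s * b * (x.1 * h (thta a b p x)) - s * G (thta a b p x) - s ^ 2 * a * b / 2 * (h (thta a b p x)) ^ 2 with hq
  have hth : ContDiff ℝ 1 (thta a b p) := by unfold thta; fun_prop
  have hqc : ContDiff ℝ 1 q := by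
    have e1 : ContDiff ℝ 1 (fun x => h (thta a b p x)) := hh1.comp hth
    have e2 : ContDiff ℝ 1 (fun x => G (thta a b p x)) := hG1.comp hth
    fun_prop
  have hql : LocallyLipschitz (fun t => q (γ t)) := hqc.locallyLipschitz.comp hγ.locallyLipschitz
  obtain ⟨K1, hK1⟩ := hql.locallyLipschitzOn.exists_lipschitzOnWith_of_compact (isCompact_Icc (a := (0:ℝ)) (b := 1))
  obtain ⟨K2, hK2⟩ := shr_lip hγ (a := a) (b := b) (p := p) hM hd hh' s
  have hftc := ftc_on zero_le_one hK1
  have hqv : q (γ 1) - q (γ 0) = - s := by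
    simp only [hq, hθ0, hθ1, hG0, hG1', hh0, hh1']; ring
  have key : ∫ t in (0:ℝ)..1, ((shr a b p h s (γ t)).1 * deriv (fun s' => (shr a b p h s (γ s')).2) t - (γ t).1 * deriv (fun s => (γ s).2) t) = ∫ t in (0:ℝ)..1, deriv (fun t => q (γ t)) t := by
    refine int_congr_Ioo zero_le_one ?_
    filter_upwards [ae_diff hγ] with t ht _
    obtain ⟨h0, h1, h2⟩ := thta_deriv (a := a) (b := b) (p := p) ht
    have hsd : HasDerivAt (fun s' => (shr a b p h s (γ s')).2) (dshr a b p h' s (γ t) (deriv γ t)).2 t :=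
      (shr_deriv (a := a) (b := b) (p := p) hd s ht).snd
    have h3 := (hd (thta a b p (γ t))).comp t h0
    have h4 := (hdG (thta a b p (γ t))).comp t h0
    have hqd : HasDerivAt (fun t => q (γ t)) (s * b * ((deriv γ t).1 * h (thta a b p (γ t)) + (γ t).1 * (h' (thta a b p (γ t)) * (b * (deriv γ t).1 + a * (deriv γ t).2)))
        - s * (h (thta a b p (γ t)) * (b * (deriv γ t).1 + a * (deriv γ t).2)) - s ^ 2 * a * b / 2 * (2 * h (thta a b p (γ t)) * (h' (thta a b p (γ t)) * (b * (deriv γ t).1 + a * (deriv γ t).2)))) t := by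
      refine ((((h1.mul h3).const_mul (s * b)).sub (h4.const_mul s)).sub ((h3.pow 2).const_mul (s ^ 2 * a * b / 2))).congr_deriv ?_
      simp [Function.comp]
    rw [hqd.deriv, deriv_snd ht]
    have : deriv (fun s' => (shr a b p h s (γ s')).2) t = (dshr a b p h' s (γ t) (deriv γ t)).2 := hsd.deriv
    rw [this]
    simp only [shr, dshr]
    ring
  rw [intervalIntegral.integral_sub (intg_aD hK2 0 1) (intg_aD hγ 0 1), hftc, hqv] at key
  unfold sArea
  linarith

end

section

set_option maxHeartbeats 1000000 in
lemma shear {W : ℝ × ℝ → ℝ} {pm pp : ℝ × ℝ} (hW : TwoWell W pm pp) {F : ℝ × ℝ → ℝ} (hF : F = fun p => Real.sqrt (W p)) (E0 : ℝ)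
    (hE0 : ∀ (γ : ℝ → ℝ × ℝ) (K : ℝ≥0), LipschitzWith K γ → γ 0 = pm → γ 1 = pp → E0 ≤ degLen F 0 1 γ) :
    ∃ C3 > 0, ∀ η > 0, ∃ s1 > 0, ∃ ε1 > 0, ε1 ≤ 1 ∧ s1 ≤ 1 ∧ ∀ (γ : ℝ → ℝ × ℝ) (K : ℝ≥0), LipschitzWith K γ → γ 0 = pm → γ 1 = pp →
      degLen F 0 1 γ ≤ E0 + ε1 → ∀ s : ℝ, |s| ≤ s1 → ∃ (γ' : ℝ → ℝ × ℝ) (K' : ℝ≥0), LipschitzWith K' γ' ∧ γ' 0 = pm ∧ γ' 1 = pp ∧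
        sArea 0 1 γ' = sArea 0 1 γ + s ∧ degLen F 0 1 γ' ≤ degLen F 0 1 γ + η * |s| ∧ Len 0 1 γ' ≤ Len 0 1 γ + C3 * |s| := by
  have hFc : Continuous F := by rw [hF]; exact hW.smooth.continuous.sqrt
  have hF0 : ∀ p, 0 ≤ F p := fun p => by rw [hF]; exact Real.sqrt_nonneg _
  obtain ⟨G, h, h', M, hM, hG1, hh1, hdG, hd, hhb, hhb', hz, hGz, hGo⟩ := exists_bump
  set u := pp - pm with hu
  set N := u.1 ^ 2 + u.2 ^ 2 with hN
  have hNp : 0 < N := by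
    have : u ≠ 0 := sub_ne_zero.2 hW.wells_ne.symm
    by_contra hc
    apply this
    have h1 : u.1 = 0 := by nlinarith [sq_nonneg u.1, sq_nonneg u.2]
    have h2 : u.2 = 0 := by nlinarith [sq_nonneg u.1, sq_nonneg u.2]
    exact Prod.ext h1 h2
  set a := u.2 / N with ha
  set b := u.1 / N with hb
  have hθm : thta a b pm pm = 0 := by simp [thta]
  have hθp : thta a b pm pp = 1 := by
    have : thta a b pm pp = b * u.1 + a * u.2 := by simp [thta, hu]
    rw [this, ha, hb]
    field_simp
    rw [hN]
  set la := |b| + |a| with hla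
  have hlap : 0 < la := by
    have h1 := thta_sub_le a b pm pp pm
    rw [hθm, hθp] at h1
    by_contra hc
    have : la = 0 := le_antisymm (not_lt.1 hc) (by positivity)
    rw [← hla, this] at h1
    norm_num at h1
  obtain ⟨m, hm, hmb⟩ := away_bound hW (r := 1 / (3 * la)) (by positivity)
  have hst : ∀ x, thta a b pm x ∈ Icc (1/3:ℝ) (2/3) → m ≤ √(W x) := by
    intro x hx
    refine hmb x ?_ ?_
    · have := thta_sub_le a b pm x pm
      rw [hθm, sub_zero, abs_of_nonneg (by linarith [hx.1])] at this
      rw [div_le_iff₀ (by positivity)]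
      have h3 := hx.1
      have e : ‖x - pm‖ * (3 * la) = 3 * (la * ‖x - pm‖) := by ring
      rw [e]; linarith
    · have := thta_sub_le a b pm x pp
      rw [hθp, abs_sub_comm, abs_of_nonneg (by linarith [hx.2])] at this
      rw [div_le_iff₀ (by positivity)]
      have h3 := hx.2
      have e : ‖x - pp‖ * (3 * la) = 3 * (la * ‖x - pp‖) := by ring
      rw [e]; linarith
  obtain ⟨cc, hcc, R0, hR0⟩ := hW.coercive
  set R1 := max R0 ‖pm‖ with hR1
  set E1 := |E0| + 1 with hE1
  have hE1p : 0 < E1 := by positivity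
  have hsc : 0 < √cc := Real.sqrt_pos.2 hcc
  obtain ⟨C, hC, hpw⟩ := pw_bound hW.smooth hW.nonneg (a := a) (b := b) (p := pm) hM hm hhb hhb' hz hst (R1 + E1 / √cc)
  refine ⟨C * E1, by positivity, fun η hη => ?_⟩
  set s1 := min 1 (η / (4 * C * E1)) with hs1
  have hs1p : 0 < s1 := by positivity
  have hs1le : s1 ≤ 1 := min_le_left _ _
  set ε1 := min 1 (s1 * η / 2) with hε1
  refine ⟨s1, hs1p, ε1, by positivity, min_le_left _ _, hs1le, fun γ K hγ hγ0 hγ1 hγE s hs => ?_⟩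
  have hEle : degLen F 0 1 γ ≤ E1 := hγE.trans (by
    have := min_le_left 1 (s1 * η / 2); have := le_abs_self E0; linarith)
  have hEnn : 0 ≤ degLen F 0 1 γ := degLen_nonneg hF0 zero_le_one
  have hrange : ∀ t ∈ Icc (0:ℝ) 1, ‖γ t‖ ≤ R1 + E1 / √cc := by
    intro t ht
    have := far_bound hFc hF0 hγ (m := √cc) (R := R1) hsc (fun x hx => by
      rw [hF]; exact Real.sqrt_le_sqrt (hR0 x ((le_max_left _ _).trans hx))) ht (by rw [hγ0]; exact le_max_right _ _)
    refine this.trans ?_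
    gcongr
  -- properties of sheared curves
  have hend : ∀ σ : ℝ, (∃ K', LipschitzWith K' (fun t => shr a b pm h σ (γ t))) ∧ shr a b pm h σ (γ 0) = pm ∧ shr a b pm h σ (γ 1) = pp := by
    intro σ
    refine ⟨shr_lip hγ hM hd hhb' σ, ?_, ?_⟩
    · have hh0 : h 0 = 0 := (hz 0 (by norm_num)).1
      rw [hγ0, shr, hθm, hh0]; simp
    · have hh0 : h 1 = 0 := (hz 1 (by norm_num)).1
      rw [hγ1, shr, hθp, hh0]; simp
  have hpwae : ∀ σ : ℝ, |σ| ≤ 1 → ∀ᵐ t, t ∈ Ioo (0:ℝ) 1 → deriv (fun t => shr a b pm h σ (γ t)) t = dshr a b pm h' σ (γ t) (deriv γ t) := by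
    intro σ hσ
    filter_upwards [ae_diff hγ] with t ht _
    exact (shr_deriv hd σ ht).deriv
  refine ⟨fun t => shr a b pm h (-s) (γ t), (hend (-s)).1.choose, (hend (-s)).1.choose_spec, (hend (-s)).2.1, (hend (-s)).2.2, ?_, ?_, ?_⟩
  · rw [shr_area hγ hM hG1 hh1 hdG hd hhb' (-s) hGz hGo (hz 0 (by norm_num)).1 (hz 1 (by norm_num)).1 (by rw [hγ0, hθm]) (by rw [hγ1, hθp])]
    ring
  · by_cases hs0 : s = 0
    · have : (fun t => shr a b pm h (-s) (γ t)) = γ := by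
        funext t; rw [hs0]; simp [shr]
      rw [this, hs0]; simp
    have hsp : 0 < |s| := abs_pos.2 hs0
    set σ := s1 / |s| * s with hσ
    have hσa : |σ| = s1 := by
      rw [hσ, abs_mul, abs_div, abs_abs, abs_of_pos hs1p]; field_simp
    obtain ⟨K1, hK1⟩ := (hend (-s)).1
    obtain ⟨K2, hK2⟩ := (hend σ).1
    have hint : s1 * degLen F 0 1 (fun t => shr a b pm h (-s) (γ t)) + |s| * degLen F 0 1 (fun t => shr a b pm h σ (γ t)) ≤
        (s1 + |s| + C * |s| * s1 * (|s| + s1)) * degLen F 0 1 γ := by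
      unfold degLen
      rw [← intervalIntegral.integral_const_mul, ← intervalIntegral.integral_const_mul, ← intervalIntegral.integral_const_mul,
        ← intervalIntegral.integral_add ((intg_eD hFc hK1 0 1).const_mul _) ((intg_eD hFc hK2 0 1).const_mul _)]
      refine int_mono_Ioo zero_le_one (((intg_eD hFc hK1 0 1).const_mul _).add ((intg_eD hFc hK2 0 1).const_mul _)) ((intg_eD hFc hγ 0 1).const_mul _) ?_
      filter_upwards [hpwae (-s) (by rw [abs_neg]; linarith), hpwae σ (by rw [hσa]; exact hs1le)] with t h1 h2 ht
      rw [h1 ht, h2 ht]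
      obtain ⟨Λ, hΛ⟩ := hpw (γ t) (deriv γ t) (hrange t ⟨ht.1.le, ht.2.le⟩)
      have k1 := (hΛ (-s) (by rw [abs_neg]; linarith)).1
      have k2 := (hΛ σ (by rw [hσa]; exact hs1le)).1
      rw [hF]
      simp only
      set k0 := √(W (γ t)) * enorm2 (deriv γ t)
      have m1 := mul_le_mul_of_nonneg_left k1 hs1p.le
      have m2 := mul_le_mul_of_nonneg_left k2 hsp.le
      have e1 : (-s) ^ 2 = |s| ^ 2 := by rw [sq_abs]; ring
      have e2 : σ ^ 2 = s1 ^ 2 := by rw [← sq_abs, hσa]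
      have e3 : |s| * (σ * Λ) = s1 * (s * Λ) := by rw [hσ]; field_simp
      rw [e1] at m1
      rw [e2] at m2
      calc _ ≤ _ := add_le_add m1 m2
        _ = (s1 + |s| + C * |s| * s1 * (|s| + s1)) * k0 + (|s| * (σ * Λ) - s1 * (s * Λ)) := by ring
        _ = _ := by rw [e3]; ring
    have hlow := hE0 _ K2 hK2 (hend σ).2.1 (hend σ).2.2
    have hlow2 : |s| * (degLen F 0 1 γ - ε1) ≤ |s| * degLen F 0 1 (fun t => shr a b pm h σ (γ t)) := by
      gcongr; linarith
    have hr1 : |s| * ε1 ≤ |s| * (s1 * η / 2) := by gcongr; exact min_le_right _ _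
    have hr2 : C * |s| * s1 * (|s| + s1) * degLen F 0 1 γ ≤ C * |s| * s1 * (2 * s1) * E1 := by
      have : |s| + s1 ≤ 2 * s1 := by linarith
      gcongr
    have hr3 : C * |s| * s1 * (2 * s1) * E1 ≤ s1 * (|s| * (η / 2)) := by
      have : s1 ≤ η / (4 * C * E1) := min_le_right _ _
      rw [le_div_iff₀ (by positivity)] at this
      calc _ = s1 * (|s| * (s1 * (4 * C * E1) / 2)) := by ring
        _ ≤ _ := by gcongr
    have hfin : s1 * degLen F 0 1 (fun t => shr a b pm h (-s) (γ t)) ≤ s1 * (degLen F 0 1 γ + η * |s|) := by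
      linarith
    exact le_of_mul_le_mul_left hfin hs1p
  · obtain ⟨K1, hK1⟩ := (hend (-s)).1
    have hint : Len 0 1 (fun t => shr a b pm h (-s) (γ t)) ≤ Len 0 1 γ + |s| * C * degLen F 0 1 γ := by
      unfold Len degLen
      rw [← intervalIntegral.integral_const_mul, ← intervalIntegral.integral_add (intg_len hγ 0 1) ((intg_eD hFc hγ 0 1).const_mul _)]
      refine int_mono_Ioo zero_le_one (intg_len hK1 0 1) ((intg_len hγ 0 1).add ((intg_eD hFc hγ 0 1).const_mul _)) ?_
      filter_upwards [hpwae (-s) (by rw [abs_neg]; linarith)] with t h1 ht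
      rw [h1 ht]
      obtain ⟨Λ, hΛ⟩ := hpw (γ t) (deriv γ t) (hrange t ⟨ht.1.le, ht.2.le⟩)
      have k1 := (hΛ (-s) (by rw [abs_neg]; linarith)).2
      rw [abs_neg] at k1
      rw [hF]
      exact k1
    have : |s| * C * degLen F 0 1 γ ≤ C * E1 * |s| := by
      calc _ ≤ |s| * C * E1 := by gcongr
        _ = _ := by ring
    linarith

end

section

variable {F : ℝ × ℝ → ℝ} {γ : ℝ → ℝ × ℝ} {K : ℝ≥0}

lemma area_loc (hF : Continuous F) (hF0 : ∀ p, 0 ≤ F p) (hγ : LipschitzWith K γ) {p : ℝ × ℝ} {c α β : ℝ} (hc : 0 < c) (hab : α ≤ β)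
    (h : ∀ t ∈ Icc α β, c * ‖γ t - p‖ ≤ F (γ t)) :
    |sArea α β γ - p.1 * ((γ β).2 - (γ α).2)| ≤ degLen F α β γ / c := by
  have hi2 : IntervalIntegrable (fun t => deriv (fun s => (γ s).2) t) volume α β :=
    intg_of_bdd (measurable_deriv _) ⟨K, fun t _ => deriv2_bd hγ t⟩
  have e : sArea α β γ - p.1 * ((γ β).2 - (γ α).2) = ∫ t in α..β, ((γ t).1 * deriv (fun s => (γ s).2) t - p.1 * deriv (fun s => (γ s).2) t) := by
    rw [intervalIntegral.integral_sub (intg_aD hγ α β) (hi2.const_mul _), intervalIntegral.integral_const_mul,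
      ftc_on hab ((lip_snd hγ).lipschitzOnWith)]
    rfl
  rw [e]
  refine (intervalIntegral.abs_integral_le_integral_abs hab).trans ?_
  unfold degLen
  rw [← intervalIntegral.integral_div]
  refine int_mono_Ioo hab ((intg_aD hγ α β).sub (hi2.const_mul _)).abs ((intg_eD hF hγ α β).div_const _) ?_
  filter_upwards [ae_diff hγ] with t ht htt
  rw [deriv_snd ht, ← sub_mul, abs_mul]
  have h1 : |(γ t).1 - p.1| ≤ ‖γ t - p‖ := norm_fst_le (γ t - p)
  have h2 : |(deriv γ t).2| ≤ enorm2 (deriv γ t) := (norm_snd_le (deriv γ t)).trans (norm_le_enorm2 _)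
  have h3 := h t ⟨htt.1.le, htt.2.le⟩
  rw [le_div_iff₀ hc]
  calc |(γ t).1 - p.1| * |(deriv γ t).2| * c ≤ ‖γ t - p‖ * enorm2 (deriv γ t) * c := by gcongr
    _ = c * ‖γ t - p‖ * enorm2 (deriv γ t) := by ring
    _ ≤ _ := by gcongr; exact enorm2_nonneg _

lemma energy_len (hF : Continuous F) (hγ : LipschitzWith K γ) {α β B : ℝ} (hB : 0 ≤ B) (hab : α ≤ β)
    (h : ∀ t ∈ Icc α β, F (γ t) ≤ B) : degLen F α β γ ≤ 2 * B * Len α β γ := by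
  unfold degLen Len
  rw [← intervalIntegral.integral_const_mul]
  refine int_mono_Ioo hab (intg_eD hF hγ α β) ((intg_len hγ α β).const_mul _) (Eventually.of_forall fun t ht => ?_)
  calc _ ≤ B * (2 * ‖deriv γ t‖) := by
        gcongr
        · exact enorm2_nonneg _
        · exact h t ⟨ht.1.le, ht.2.le⟩
        · exact enorm2_le _
    _ = _ := by ring

lemma cut_curve (hF : Continuous F) (hγ : LipschitzWith K γ) {p : ℝ × ℝ} {C r α β : ℝ} (hC : 0 ≤ C)
    (hα : 0 ≤ α) (hab : α < β) (hβ : β ≤ 1) (h : γ α = p ∨ γ β = p) (h1 : ‖γ α - p‖ ≤ r) (h2 : ‖γ β - p‖ ≤ r)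
    (hup : ∀ x, ‖x - p‖ ≤ r → F x ≤ C * ‖x - p‖) :
    ∃ (γ1 : ℝ → ℝ × ℝ) (K1 : ℝ≥0), LipschitzWith K1 γ1 ∧ γ1 0 = γ 0 ∧ γ1 1 = γ 1 ∧ γ1 α = γ α ∧ γ1 β = γ β ∧
      (∀ t ∈ Icc α β, ‖γ1 t - p‖ ≤ r) ∧
      degLen F 0 1 γ1 = degLen F 0 1 γ - degLen F α β γ + degLen F α β γ1 ∧
      sArea 0 1 γ1 = sArea 0 1 γ - sArea α β γ + sArea α β γ1 ∧
      Len 0 1 γ1 = Len 0 1 γ - Len α β γ + Len α β γ1 ∧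
      degLen F α β γ1 ≤ 2 * C * r ^ 2 ∧ Len α β γ1 ≤ r := by
  have hr : 0 ≤ r := (norm_nonneg _).trans h1
  have hdr : ‖γ β - γ α‖ ≤ r := by
    rcases h with h | h
    · rw [h]; exact h2
    · rw [h, norm_sub_rev]; exact h1
  have hba : 0 < β - α := sub_pos.2 hab
  set γ1 : ℝ → ℝ × ℝ := fun t => γ (min t α) + ((max α (min t β) - α) / (β - α)) • (γ β - γ α) + (γ (max t β) - γ β) with hγ1
  have hlin : ∀ t ∈ Icc α β, γ1 t = γ α + ((t - α) / (β - α)) • (γ β - γ α) := by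
    intro t ht
    simp only [hγ1]
    rw [min_eq_right ht.1, min_eq_left ht.2, max_eq_right ht.1, max_eq_right ht.2, sub_self, add_zero]
  have hleft : ∀ t, t ≤ α → γ1 t = γ t := by
    intro t ht
    simp only [hγ1]
    rw [min_eq_left ht, min_eq_left (ht.trans hab.le), max_eq_left ht, max_eq_right (ht.trans hab.le)]
    simp
  have hright : ∀ t, β ≤ t → γ1 t = γ t := by
    intro t ht
    simp only [hγ1]
    rw [min_eq_right (hab.le.trans ht), min_eq_right ht, max_eq_right hab.le, max_eq_left ht, div_self hba.ne']
    simp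
  have hlip : ∃ K1, LipschitzWith K1 γ1 := by
    have l1 : LipschitzWith (K * 1) (fun t => γ (min t α)) := hγ.comp (LipschitzWith.id.min_const α)
    have l2 : LipschitzWith (K * 1) (fun t => γ (max t β)) := hγ.comp (LipschitzWith.id.max_const β)
    have l3 : LipschitzWith 1 (fun t : ℝ => max α (min t β)) := (LipschitzWith.id.min_const β).const_max α
    have l4 : LipschitzWith ⟨‖γ β - γ α‖ / (β - α), by positivity⟩ (fun t : ℝ => ((max α (min t β) - α) / (β - α)) • (γ β - γ α)) := by
      refine LipschitzWith.of_dist_le_mul fun s t => ?_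
      rw [dist_eq_norm, ← sub_smul, norm_smul, ← sub_div, sub_sub_sub_cancel_right, norm_div, Real.norm_of_nonneg hba.le]
      have := l3.dist_le_mul s t
      rw [NNReal.coe_one, one_mul, dist_eq_norm] at this
      calc _ ≤ dist s t / (β - α) * ‖γ β - γ α‖ := by gcongr
        _ = ‖γ β - γ α‖ / (β - α) * dist s t := by ring
    exact ⟨_, (l1.add l4).add (l2.sub (LipschitzWith.const (γ β)))⟩
  obtain ⟨K1, hK1⟩ := hlip
  have hin : ∀ t ∈ Icc α β, ‖γ1 t - p‖ ≤ r := by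
    intro t ht
    have hm : γ1 t ∈ Metric.closedBall p r := by
      rw [hlin t ht]
      refine (convex_closedBall p r).add_smul_sub_mem (by simpa [dist_eq_norm] using h1) (by simpa [dist_eq_norm] using h2) ⟨?_, ?_⟩
      · exact div_nonneg (sub_nonneg.2 ht.1) hba.le
      · rw [div_le_one hba]; linarith [ht.2]
    simpa [dist_eq_norm] using hm
  have hder : ∀ t ∈ Ioo α β, deriv γ1 t = (β - α)⁻¹ • (γ β - γ α) := by
    intro t ht
    rw [deriv_congr_Ioo (γ' := fun t => γ α + ((t - α) / (β - α)) • (γ β - γ α)) (fun s hs => hlin s ⟨hs.1.le, hs.2.le⟩) ht]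
    have : HasDerivAt (fun t : ℝ => γ α + ((t - α) / (β - α)) • (γ β - γ α)) ((1 / (β - α)) • (γ β - γ α)) t :=
      ((((hasDerivAt_id t).sub_const α).div_const (β - α)).smul_const (γ β - γ α)).const_add (γ α)
    rw [this.deriv, one_div]
  have hlen : Len α β γ1 ≤ r := by
    have : Len α β γ1 = ∫ t in α..β, (β - α)⁻¹ * ‖γ β - γ α‖ := by
      refine int_congr_Ioo hab.le (Eventually.of_forall fun t ht => ?_)
      rw [hder t ht, norm_smul, norm_inv, Real.norm_of_nonneg hba.le]
    rw [this, intervalIntegral.integral_const, smul_eq_mul, mul_inv_cancel_left₀ hba.ne']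
    exact hdr
  have hen : degLen F α β γ1 ≤ 2 * C * r ^ 2 := by
    have := energy_len hF hK1 (B := C * r) (by positivity) hab.le (fun t ht => (hup _ (hin t ht)).trans (by gcongr; exact hin t ht))
    refine this.trans ?_
    calc 2 * (C * r) * Len α β γ1 ≤ 2 * (C * r) * r := by gcongr
      _ = _ := by ring
  have eL : ∀ t ∈ Ioo (0:ℝ) α, γ1 t = γ t := fun t ht => hleft t ht.2.le
  have eR : ∀ t ∈ Ioo β (1:ℝ), γ1 t = γ t := fun t ht => hright t ht.1.le
  refine ⟨γ1, K1, hK1, hleft 0 hα, hright 1 hβ, hleft α le_rfl, hright β le_rfl, hin, ?_, ?_, ?_, hen, hlen⟩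
  · have a1 := degLen_add hF hγ 0 α 1
    have a2 := degLen_add hF hγ α β 1
    have b1 := degLen_add hF hK1 0 α 1
    have b2 := degLen_add hF hK1 α β 1
    rw [degLen_congr hα eL] at b1
    rw [degLen_congr hβ eR] at b2
    linarith
  · have a1 := sArea_add hγ 0 α 1
    have a2 := sArea_add hγ α β 1
    have b1 := sArea_add hK1 0 α 1
    have b2 := sArea_add hK1 α β 1
    rw [sArea_congr hα eL] at b1
    rw [sArea_congr hβ eR] at b2
    linarith
  · have a1 := Len_add hγ 0 α 1
    have a2 := Len_add hγ α β 1
    have b1 := Len_add hK1 0 α 1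
    have b2 := Len_add hK1 α β 1
    rw [Len_congr hα eL] at b1
    rw [Len_congr hβ eR] at b2
    linarith

def ShearOK (F : ℝ × ℝ → ℝ) (pm pp : ℝ × ℝ) (E0 C3 η s1 ε1 : ℝ) : Prop :=
  ∀ (γ : ℝ → ℝ × ℝ) (K : ℝ≥0), LipschitzWith K γ → γ 0 = pm → γ 1 = pp →
      degLen F 0 1 γ ≤ E0 + ε1 → ∀ s : ℝ, |s| ≤ s1 → ∃ (γ' : ℝ → ℝ × ℝ) (K' : ℝ≥0), LipschitzWith K' γ' ∧ γ' 0 = pm ∧ γ' 1 = pp ∧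
        sArea 0 1 γ' = sArea 0 1 γ + s ∧ degLen F 0 1 γ' ≤ degLen F 0 1 γ + η * |s| ∧ Len 0 1 γ' ≤ Len 0 1 γ + C3 * |s|

set_option maxHeartbeats 1000000 in
lemma improve (hF : Continuous F) (hF0 : ∀ p, 0 ≤ F p) (hγ : LipschitzWith K γ) {pm pp p : ℝ × ℝ}
    {E0 C3 s1 ε c C r ρ ρ1 α β : ℝ} (hc : 0 < c) (hC : 0 < C) (hC3 : 0 < C3) (hρ : 0 < ρ)
    (hE0 : ∀ (γ : ℝ → ℝ × ℝ) (K : ℝ≥0), LipschitzWith K γ → γ 0 = pm → γ 1 = pp → E0 ≤ degLen F 0 1 γ)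
    (hsh : ShearOK F pm pp E0 C3 (c / 4) s1 ε)
    (hlo : ∀ x, ‖x - p‖ ≤ ρ → c * ‖x - p‖ ≤ F x) (hup : ∀ x, ‖x - p‖ ≤ ρ → F x ≤ C * ‖x - p‖)
    (k1 : C3 * (2 / c) * (2 * (C * ρ)) ≤ 1 / 4) (k2 : ε + 2 * C * ρ1 ^ 2 < c / 2 * ρ ^ 2)
    (k3 : (2 / c) * (ε + 2 * C * ρ1 ^ 2) ≤ s1) (k4 : ρ1 ≤ ρ)
    (g0 : γ 0 = pm) (g1 : γ 1 = pp) (gE : degLen F 0 1 γ ≤ E0 + ε)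
    (hα : 0 ≤ α) (hab : α < β) (hβ : β ≤ 1) (h : γ α = p ∨ γ β = p) (h1 : ‖γ α - p‖ ≤ r) (h2 : ‖γ β - p‖ ≤ r)
    (hr1 : r ≤ ρ1) (hbig : 8 * C * r ^ 2 < degLen F α β γ) :
    ∃ (γ2 : ℝ → ℝ × ℝ) (K2 : ℝ≥0), LipschitzWith K2 γ2 ∧ γ2 0 = pm ∧ γ2 1 = pp ∧ sArea 0 1 γ2 = sArea 0 1 γ ∧
      degLen F 0 1 γ2 < degLen F 0 1 γ ∧ Len 0 1 γ2 < Len 0 1 γ := by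
  have hr : 0 ≤ r := (norm_nonneg _).trans h1
  obtain ⟨γ1, K1, hK1, c0, c1, cα, cβ, cin, cE, cA, cL, cen, clen⟩ := cut_curve hF hγ hC.le hα hab hβ h h1 h2
    (fun x hx => hup x (hx.trans (hr1.trans k4)))
  set e := degLen F α β γ with he
  set es := degLen F α β γ1 with hes
  set ℓ := Len α β γ with hℓ
  have hrr : r ^ 2 ≤ ρ1 ^ 2 := by gcongr
  have hCr : 2 * C * r ^ 2 ≤ 2 * C * ρ1 ^ 2 := by gcongr
  have hCr0 : 0 ≤ C * r ^ 2 := by positivity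
  have hes0 : 0 ≤ es := degLen_nonneg hF0 hab.le
  have hlow := hE0 γ1 K1 hK1 (c0.trans g0) (c1.trans g1)
  have hee : e ≤ ε + 2 * C * ρ1 ^ 2 := by linarith
  have hconf : ∀ t ∈ Icc α β, ‖γ t - p‖ ≤ ρ := fun t ht =>
    (confine' hF hF0 hγ hc hρ hlo ht h (by rw [← he]; linarith)).1
  have ha1 := area_loc hF hF0 hγ hc hab.le (fun t ht => hlo _ (hconf t ht))
  have ha2 := area_loc hF hF0 hK1 hc hab.le (fun t ht => hlo _ ((cin t ht).trans (hr1.trans k4)))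
  rw [cα, cβ] at ha2
  have hδ : |sArea α β γ - sArea α β γ1| ≤ 2 / c * e := by
    have : 2 / c * e = e / c + e / c := by ring
    have h3 : es / c ≤ e / c := by gcongr; linarith
    rw [this]
    rw [abs_le] at *
    constructor <;> linarith
  set δ := sArea α β γ - sArea α β γ1 with hδd
  have hδs : |δ| ≤ s1 := hδ.trans (le_trans (by gcongr) k3)
  obtain ⟨γ2, K2, hK2, d0, d1, dA, dE, dL⟩ := hsh γ1 K1 hK1 (c0.trans g0) (c1.trans g1) (by linarith) δ hδs
  refine ⟨γ2, K2, hK2, d0, d1, by rw [dA, cA]; ring, ?_, ?_⟩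
  · have : c / 4 * |δ| ≤ e / 2 := by
      calc c / 4 * |δ| ≤ c / 4 * (2 / c * e) := by gcongr
        _ = e / 2 := by field_simp; ring
    linarith
  · have hℓn : ∀ t ∈ Icc α β, ‖γ t - p‖ ≤ ℓ := by
      intro t ht
      have l1 := Len_add hγ α t β
      have l2 := Len_nonneg (γ := γ) ht.1
      have l3 := Len_nonneg (γ := γ) ht.2
      rcases h with h | h
      · have := norm_sub_le_Len hγ ht.1
        rw [h] at this; linarith
      · have := norm_sub_le_Len hγ ht.2
        rw [h, norm_sub_rev] at this; linarith
    have hℓ0 : 0 ≤ ℓ := Len_nonneg hab.le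
    have b1 : e ≤ 2 * (C * ρ) * ℓ := energy_len hF hγ (by positivity) hab.le
      (fun t ht => (hup _ (hconf t ht)).trans (by gcongr; exact hconf t ht))
    have b2 : e ≤ 2 * (C * ℓ) * ℓ := energy_len hF hγ (by positivity) hab.le
      (fun t ht => (hup _ (hconf t ht)).trans (by gcongr; exact hℓn t ht))
    have b3 : (2 * r) ^ 2 < ℓ ^ 2 := by
      have : C * (2 * r) ^ 2 < C * ℓ ^ 2 := by nlinarith
      exact lt_of_mul_lt_mul_left this hC.le
    have b4 : 2 * r < ℓ := lt_of_pow_lt_pow_left₀ 2 hℓ0 b3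
    have b5 : C3 * |δ| ≤ 1 / 4 * ℓ := by
      calc C3 * |δ| ≤ C3 * (2 / c * (2 * (C * ρ) * ℓ)) := by gcongr; exact hδ.trans (by gcongr)
        _ = C3 * (2 / c) * (2 * (C * ρ)) * ℓ := by ring
        _ ≤ _ := by gcongr
    linarith

end

section

lemma sqrt_diff {x y m : ℝ} (hm : 0 < m) (hx : m ≤ x) (hy : m ≤ y) : |√x - √y| ≤ 1 / √m * |x - y| := by
  have h1 : 0 < √m := Real.sqrt_pos.2 hm
  have h2 : √m ≤ √x := Real.sqrt_le_sqrt hx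
  have h3 : √m ≤ √y := Real.sqrt_le_sqrt hy
  have e : x - y = (√x - √y) * (√x + √y) := by
    have a := Real.sq_sqrt (hm.le.trans hx)
    have b := Real.sq_sqrt (hm.le.trans hy)
    nlinarith
  rw [e, abs_mul, abs_of_pos (by linarith : 0 < √x + √y), div_mul_eq_mul_div, le_div_iff₀ h1, one_mul]
  gcongr
  linarith

lemma length_bound {F : ℝ × ℝ → ℝ} {γ : ℝ → ℝ × ℝ} {K : ℝ≥0} (hF : Continuous F) (hF0 : ∀ p, 0 ≤ F p) (hγ : LipschitzWith K γ)
    {κ : ℝ} (hκ : 0 < κ) (hE : 0 < degLen F 0 1 γ)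
    (h : ∀ t ∈ Icc (0:ℝ) 1, κ * √(degLen F 0 t γ) ≤ F (γ t) ∨ κ * √(degLen F 0 1 γ - degLen F 0 t γ) ≤ F (γ t))
    (hz0 : ∀ t ∈ Icc (0:ℝ) 1, degLen F 0 t γ = 0 → Len 0 t γ = 0)
    (hz1 : ∀ t ∈ Icc (0:ℝ) 1, degLen F 0 t γ = degLen F 0 1 γ → Len t 1 γ = 0) :
    Len 0 1 γ ≤ 4 / κ * √(degLen F 0 1 γ) := by
  set E := degLen F 0 1 γ with hEd
  set e : ℝ → ℝ := fun t => degLen F 0 t γ with he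
  obtain ⟨M, hM⟩ := bd_eD hF hγ 0 1
  rw [uIcc_of_le zero_le_one] at hM
  have hel : LipschitzOnWith M.toNNReal e (Icc 0 1) := prim_lip zero_le_one (meas_eD hF hγ) hM
  have hed := prim_deriv zero_le_one (meas_eD hF hγ) hM
  have hmono : ∀ s t : ℝ, s ≤ t → e s ≤ e t := by
    intro s t hst
    have := degLen_add hF hγ 0 s t
    have := degLen_nonneg (γ := γ) hF0 hst
    simp only [he]; linarith
  have he0 : e 0 = 0 := by simp [he, degLen]
  have he1 : e 1 = E := rfl
  have hcpt : ∀ v, IsCompact {t ∈ Icc (0:ℝ) 1 | e t = v} := by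
    intro v
    have : {t ∈ Icc (0:ℝ) 1 | e t = v} = Icc 0 1 ∩ e ⁻¹' {v} := rfl
    rw [this]
    exact isCompact_Icc.of_isClosed_subset (hel.continuousOn.preimage_isClosed_of_isClosed isClosed_Icc isClosed_singleton) inter_subset_left
  obtain ⟨t0, ⟨ht0, ht0e⟩, hg0⟩ := (hcpt 0).exists_isGreatest ⟨0, ⟨left_mem_Icc.2 zero_le_one, he0⟩⟩
  obtain ⟨t1, ⟨ht1, ht1e⟩, hl1⟩ := (hcpt E).exists_isLeast ⟨1, ⟨right_mem_Icc.2 zero_le_one, he1⟩⟩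
  have h01 : t0 < t1 := by
    by_contra hc
    have := hmono _ _ (not_lt.1 hc)
    rw [ht0e, ht1e] at this; linarith
  have key : ∀ τ1 τ2, t0 < τ1 → τ1 ≤ τ2 → τ2 < t1 → Len τ1 τ2 γ ≤ 4 / κ * √E := by
    intro τ1 τ2 h1 h12 h2
    have hτ1 : τ1 ∈ Icc (0:ℝ) 1 := ⟨by linarith [ht0.1], by linarith [ht1.2]⟩
    have hτ2 : τ2 ∈ Icc (0:ℝ) 1 := ⟨by linarith [ht0.1], by linarith [ht1.2]⟩
    have hsub : Icc τ1 τ2 ⊆ Icc 0 1 := Icc_subset_Icc hτ1.1 hτ2.2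
    have hp1 : 0 < e τ1 := by
      refine lt_of_le_of_ne (by rw [← he0]; exact hmono _ _ hτ1.1) fun hc => ?_
      have := hg0 ⟨hτ1, hc.symm⟩
      linarith
    have hp2 : 0 < E - e τ2 := by
      have a : e τ2 ≤ E := hmono _ _ hτ2.2
      rcases a.lt_or_eq with a | a
      · linarith
      · have := hl1 ⟨hτ2, a⟩; linarith
    set m := min (e τ1) (E - e τ2) with hm
    have hmp : 0 < m := lt_min hp1 hp2
    have hr1 : ∀ t ∈ Icc τ1 τ2, m ≤ e t := fun t ht => (min_le_left _ _).trans (hmono _ _ ht.1)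
    have hr2 : ∀ t ∈ Icc τ1 τ2, m ≤ E - e t := fun t ht => (min_le_right _ _).trans (by linarith [hmono _ _ ht.2])
    set f : ℝ → ℝ := fun t => √(e t) - √(E - e t) with hf
    have hfl : LipschitzOnWith (2 / √m * M.toNNReal).toNNReal f (Icc τ1 τ2) := by
      apply LipschitzOnWith.of_dist_le'
      intro s hs t ht
      have a1 := hel.dist_le_mul s (hsub hs) t (hsub ht)
      rw [Real.dist_eq] at a1
      have a2 := sqrt_diff hmp (hr1 s hs) (hr1 t ht)
      have a3 := sqrt_diff hmp (hr2 s hs) (hr2 t ht)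
      have a4 : |E - e s - (E - e t)| = |e s - e t| := by rw [sub_sub_sub_cancel_left, abs_sub_comm]
      rw [a4] at a3
      rw [Real.dist_eq]
      have a5 : f s - f t = (√(e s) - √(e t)) - (√(E - e s) - √(E - e t)) := by simp only [hf]; ring
      rw [a5]
      calc _ ≤ |√(e s) - √(e t)| + |√(E - e s) - √(E - e t)| := abs_sub _ _
        _ ≤ 2 / √m * |e s - e t| := by
          have : 2 / √m * |e s - e t| = 1 / √m * |e s - e t| + 1 / √m * |e s - e t| := by ring
          linarith
        _ ≤ 2 / √m * (M.toNNReal * dist s t) := by gcongr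
        _ = _ := by ring
    have hint := int_le_sub h12 hfl ((intg_len hγ τ1 τ2).const_mul (κ / 2)) (by
      filter_upwards [hed] with t ht htt
      have htI : t ∈ Icc τ1 τ2 := ⟨htt.1.le, htt.2.le⟩
      have hd : HasDerivAt e (F (γ t) * enorm2 (deriv γ t)) t := ht (hsub htI)
      have q1 : 0 < e t := hmp.trans_le (hr1 t htI)
      have q2 : 0 < E - e t := hmp.trans_le (hr2 t htI)
      have hfd : HasDerivAt f (F (γ t) * enorm2 (deriv γ t) / (2 * √(e t)) - (-(F (γ t) * enorm2 (deriv γ t))) / (2 * √(E - e t))) t :=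
        (hd.sqrt q1.ne').sub ((hd.const_sub E).sqrt q2.ne')
      rw [hfd.deriv]
      set g := F (γ t) * enorm2 (deriv γ t) with hg
      have hg0 : 0 ≤ g := mul_nonneg (hF0 _) (enorm2_nonneg _)
      have r1 : 0 < √(e t) := Real.sqrt_pos.2 q1
      have r2 : 0 < √(E - e t) := Real.sqrt_pos.2 q2
      have s1 : 0 ≤ g / (2 * √(e t)) := by positivity
      have s2 : 0 ≤ g / (2 * √(E - e t)) := by positivity
      have hnn := norm_le_enorm2 (deriv γ t)
      rw [neg_div, sub_neg_eq_add]
      rcases h t (hsub htI) with hh | hh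
      · have : κ / 2 * ‖deriv γ t‖ ≤ g / (2 * √(e t)) := by
          rw [le_div_iff₀ (by positivity), hg]
          calc κ / 2 * ‖deriv γ t‖ * (2 * √(e t)) = (κ * √(e t)) * ‖deriv γ t‖ := by ring
            _ ≤ _ := by gcongr; exact hF0 _
        linarith
      · have : κ / 2 * ‖deriv γ t‖ ≤ g / (2 * √(E - e t)) := by
          rw [le_div_iff₀ (by positivity), hg]
          calc κ / 2 * ‖deriv γ t‖ * (2 * √(E - e t)) = (κ * √(E - e t)) * ‖deriv γ t‖ := by ring
            _ ≤ _ := by gcongr; exact hF0 _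
        linarith)
    rw [intervalIntegral.integral_const_mul] at hint
    have hb : f τ2 - f τ1 ≤ 2 * √E := by
      have b1 : √(e τ2) ≤ √E := Real.sqrt_le_sqrt (by linarith)
      have b2 : √(E - e τ1) ≤ √E := Real.sqrt_le_sqrt (by linarith)
      have b3 := Real.sqrt_nonneg (e τ1)
      have b4 := Real.sqrt_nonneg (E - e τ2)
      simp only [hf]; linarith
    have : κ / 2 * Len τ1 τ2 γ ≤ 2 * √E := hint.trans hb
    rw [div_mul_eq_mul_div, le_div_iff₀ hκ]
    linarith
  have hshort : ∀ s t : ℝ, s ≤ t → Len s t γ ≤ K * (t - s) := by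
    intro s t hst
    have := int_mono_Ioo hst (intg_len hγ s t) (intervalIntegrable_const (c := (K:ℝ))) (Eventually.of_forall fun u _ => deriv_bd hγ u)
    rw [intervalIntegral.integral_const, smul_eq_mul] at this
    unfold Len; linarith
  have l0 := hz0 t0 ht0 ht0e
  have l1 := hz1 t1 ht1 ht1e
  refine le_of_forall_pos_le_add fun ε hε => ?_
  set d := min ((t1 - t0) / 3) (ε / (2 * (K + 1))) with hd
  have hdp : 0 < d := lt_min (by linarith) (by positivity)
  have hd1 : d ≤ (t1 - t0) / 3 := min_le_left _ _
  have hd2 : K * d ≤ ε / 2 := by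
    have : d ≤ ε / (2 * (K + 1)) := min_le_right _ _
    rw [le_div_iff₀ (by positivity)] at this
    linarith
  have k := key (t0 + d) (t1 - d) (by linarith) (by linarith) (by linarith)
  have a1 := hshort t0 (t0 + d) (by linarith)
  have a2 := hshort (t1 - d) t1 (by linarith)
  have b1 := Len_add hγ 0 t0 1
  have b2 := Len_add hγ t0 (t0 + d) 1
  have b3 := Len_add hγ (t0 + d) (t1 - d) 1
  have b4 := Len_add hγ (t1 - d) t1 1
  rw [add_sub_cancel_left] at a1
  rw [sub_sub_cancel] at a2
  linarith

end

lemma Len_le_K {γ : ℝ → ℝ × ℝ} {K : ℝ≥0} (hγ : LipschitzWith K γ) : Len 0 1 γ ≤ K := by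
  have := int_mono_Ioo zero_le_one (intg_len hγ 0 1) (intervalIntegrable_const (c := (K:ℝ))) (Eventually.of_forall fun u _ => deriv_bd hγ u)
  rw [intervalIntegral.integral_const, smul_eq_mul] at this
  unfold Len; linarith

lemma Len_const {γ : ℝ → ℝ × ℝ} {p : ℝ × ℝ} {a b : ℝ} (hab : a ≤ b) (h : ∀ t ∈ Icc a b, γ t = p) : Len a b γ = 0 := by
  rw [Len_congr (γ' := fun _ => p) hab (fun t ht => h t ⟨ht.1.le, ht.2.le⟩)]
  simp [Len]

lemma confine_zero {F : ℝ × ℝ → ℝ} {γ : ℝ → ℝ × ℝ} {K : ℝ≥0} (hF : Continuous F) (hF0 : ∀ p, 0 ≤ F p) (hγ : LipschitzWith K γ)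
    {p : ℝ × ℝ} {c ρ : ℝ} (hc : 0 < c) (hρ : 0 < ρ) (hw : ∀ x, ‖x - p‖ ≤ ρ → c * ‖x - p‖ ≤ F x)
    {α β : ℝ} (hab : α ≤ β) (h : γ α = p ∨ γ β = p) (hE : degLen F α β γ = 0) : Len α β γ = 0 := by
  refine Len_const (p := p) hab fun t ht => ?_
  have := (confine' hF hF0 hγ hc hρ hw ht h (by rw [hE]; positivity)).2
  rw [hE] at this
  by_contra hne
  have : 0 < ‖γ t - p‖ := norm_pos_iff.2 (sub_ne_zero.2 hne)
  have : 0 < c / 2 * ‖γ t - p‖ ^ 2 := by positivity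
  linarith

lemma min_len {F : ℝ × ℝ → ℝ} {γ : ℝ → ℝ × ℝ} {L : ℝ≥0} (hF : Continuous F) (hF0 : ∀ p, 0 ≤ F p) (hγ : LipschitzWith L γ) {pm pp : ℝ × ℝ}
    (hne : pm ≠ pp)
    {E0 C3 s1 ε c C ρ ρ1 m0 : ℝ} (hc : 0 < c) (hC : 0 < C) (hC3 : 0 < C3) (hρ : 0 < ρ) (hρ1 : 0 < ρ1) (hm0 : 0 < m0) (hE00 : 0 ≤ E0) (hε1 : ε ≤ 1)
    (hE0 : ∀ (γ : ℝ → ℝ × ℝ) (K : ℝ≥0), LipschitzWith K γ → γ 0 = pm → γ 1 = pp → E0 ≤ degLen F 0 1 γ)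
    (hsh : ShearOK F pm pp E0 C3 (c / 4) s1 ε)
    (hlom : ∀ x, ‖x - pm‖ ≤ ρ → c * ‖x - pm‖ ≤ F x) (hupm : ∀ x, ‖x - pm‖ ≤ ρ → F x ≤ C * ‖x - pm‖)
    (hlop : ∀ x, ‖x - pp‖ ≤ ρ → c * ‖x - pp‖ ≤ F x) (hupp : ∀ x, ‖x - pp‖ ≤ ρ → F x ≤ C * ‖x - pp‖)
    (haw : ∀ x, ρ1 ≤ ‖x - pm‖ → ρ1 ≤ ‖x - pp‖ → m0 ≤ F x)
    (k1 : C3 * (2 / c) * (2 * (C * ρ)) ≤ 1 / 4) (k2 : ε + 2 * C * ρ1 ^ 2 < c / 2 * ρ ^ 2)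
    (k3 : (2 / c) * (ε + 2 * C * ρ1 ^ 2) ≤ s1) (k4 : ρ1 ≤ ρ)
    (g0 : γ 0 = pm) (g1 : γ 1 = pp) (gE : degLen F 0 1 γ ≤ E0 + ε)
    (hmin : ∀ γ', LipschitzWith L γ' → γ' 0 = pm → γ' 1 = pp → sArea 0 1 γ' = sArea 0 1 γ → degLen F 0 1 γ ≤ degLen F 0 1 γ') :
    Len 0 1 γ ≤ 4 / (min (c / √(8 * C)) (m0 / √(E0 + 1))) * √(E0 + 1) := by
  have hno : ∀ (γ2 : ℝ → ℝ × ℝ) (K2 : ℝ≥0), LipschitzWith K2 γ2 → γ2 0 = pm → γ2 1 = pp → sArea 0 1 γ2 = sArea 0 1 γ →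
      degLen F 0 1 γ2 < degLen F 0 1 γ → Len 0 1 γ2 < Len 0 1 γ → False := by
    intro γ2 K2 h2 h20 h21 hA hE hL
    obtain ⟨γ3, h3, h30, h31, h3E, h3A⟩ := reparam hF h2 zero_lt_one (hL.trans_le (Len_le_K hγ))
    have := hmin γ3 h3 (h30.trans h20) (h31.trans h21) (h3A.trans hA)
    linarith
  have hm : ∀ t ∈ Icc (0:ℝ) 1, ‖γ t - pm‖ ≤ ρ1 → degLen F 0 t γ ≤ 8 * C * ‖γ t - pm‖ ^ 2 := by
    intro t ht hr
    rcases ht.1.eq_or_lt with h0 | h0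
    · rw [← h0, g0]; simp [degLen]
    by_contra hc'
    obtain ⟨γ2, K2, a1, a2, a3, a4, a5, a6⟩ := improve hF hF0 hγ hc hC hC3 hρ hE0 hsh hlom hupm k1 k2 k3 k4 g0 g1 gE le_rfl h0 ht.2 (Or.inl g0)
      (r := ‖γ t - pm‖) (by rw [g0]; simp) le_rfl hr (not_le.1 hc')
    exact hno γ2 K2 a1 a2 a3 a4 a5 a6
  have hp : ∀ t ∈ Icc (0:ℝ) 1, ‖γ t - pp‖ ≤ ρ1 → degLen F t 1 γ ≤ 8 * C * ‖γ t - pp‖ ^ 2 := by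
    intro t ht hr
    rcases ht.2.eq_or_lt with h0 | h0
    · rw [h0, g1]; simp [degLen]
    by_contra hc'
    obtain ⟨γ2, K2, a1, a2, a3, a4, a5, a6⟩ := improve hF hF0 hγ hc hC hC3 hρ hE0 hsh hlop hupp k1 k2 k3 k4 g0 g1 gE ht.1 h0 le_rfl (Or.inr g1)
      (r := ‖γ t - pp‖) le_rfl (by rw [g1]; simp) hr (not_le.1 hc')
    exact hno γ2 K2 a1 a2 a3 a4 a5 a6
  have hEle : degLen F 0 1 γ ≤ E0 + 1 := by linarith
  have hEpos : 0 < degLen F 0 1 γ := by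
    have h1 := confine hF hF0 hγ hc hρ hlom (right_mem_Icc.2 zero_le_one) (Or.inl g0)
    refine lt_of_lt_of_le ?_ h1
    have : 0 < min ‖γ 1 - pm‖ ρ := lt_min (by rw [g1]; exact norm_pos_iff.2 (sub_ne_zero.2 hne.symm)) hρ
    positivity
  have hE1 : 0 < √(E0 + 1) := Real.sqrt_pos.2 (by linarith)
  have h8 : 0 < √(8 * C) := Real.sqrt_pos.2 (by linarith)
  set κ := min (c / √(8 * C)) (m0 / √(E0 + 1)) with hκ
  have hκp : 0 < κ := lt_min (by positivity) (by positivity)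
  have hsp : ∀ t, degLen F 0 1 γ - degLen F 0 t γ = degLen F t 1 γ := fun t => by
    have := degLen_add hF hγ 0 t 1; linarith
  have hnear : ∀ (x : ℝ × ℝ) (p : ℝ × ℝ) (w : ℝ), c * ‖x - p‖ ≤ F x → w ≤ 8 * C * ‖x - p‖ ^ 2 → κ * √w ≤ F x := by
    intro x p w h1 h2
    have h3 : √w ≤ √(8 * C) * ‖x - p‖ := by
      calc √w ≤ √(8 * C * ‖x - p‖ ^ 2) := Real.sqrt_le_sqrt h2
        _ = _ := by rw [Real.sqrt_mul (by linarith), Real.sqrt_sq (norm_nonneg _)]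
    calc κ * √w ≤ c / √(8 * C) * (√(8 * C) * ‖x - p‖) := by gcongr; exact min_le_left _ _
      _ = c * ‖x - p‖ := by field_simp
      _ ≤ _ := h1
  refine (length_bound hF hF0 hγ hκp hEpos ?_ ?_ ?_).trans (by gcongr)
  · intro t ht
    by_cases h1 : ‖γ t - pm‖ ≤ ρ1
    · left; exact hnear _ _ _ (hlom _ (h1.trans k4)) (hm t ht h1)
    by_cases h2 : ‖γ t - pp‖ ≤ ρ1
    · right; rw [hsp]; exact hnear _ _ _ (hlop _ (h2.trans k4)) (hp t ht h2)
    left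
    have h3 := haw (γ t) (not_le.1 h1).le (not_le.1 h2).le
    have h4 : degLen F 0 t γ ≤ E0 + 1 := (degLen_mono hF hF0 hγ le_rfl ht.1 ht.2).trans hEle
    calc κ * √(degLen F 0 t γ) ≤ m0 / √(E0 + 1) * √(E0 + 1) := by gcongr; exact min_le_right _ _
      _ = m0 := by field_simp
      _ ≤ _ := h3
  · intro t ht h
    exact confine_zero hF hF0 hγ hc hρ hlom ht.1 (Or.inl g0) h
  · intro t ht h
    exact confine_zero hF hF0 hγ hc hρ hlop ht.2 (Or.inr g1) (by rw [← hsp]; linarith)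

/-- main existence theorem: if `γ₀` is an unconstrained minimizing geodesic from
`p₋` to `p₊`, then there is `ε₀ > 0` such that for every `A` with `|A − 𝒜(γ₀)| < ε₀` the
isoperimetric problem with constraint `A` has a solution. -/
theorem main_existence
    (W : ℝ × ℝ → ℝ) (pm pp : ℝ × ℝ) (hW : TwoWell W pm pp)
    (F : ℝ × ℝ → ℝ) (hF : F = fun p => Real.sqrt (W p))
    (γ0 : ℝ → ℝ × ℝ) (hγ0 : IsCurve 0 1 γ0 pm pp)
    (hmin : ∀ a b γ, IsCurve a b γ pm pp → degLen F 0 1 γ0 ≤ degLen F a b γ) :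
    ∃ ε0 > (0:ℝ), ∀ A : ℝ, |A - sArea 0 1 γ0| < ε0 →
      ∃ a b γ, IsoSol F pm pp A a b γ := by
  have hFc : Continuous F := by rw [hF]; exact hW.smooth.continuous.sqrt
  have hF0 : ∀ p, 0 ≤ F p := fun p => by rw [hF]; exact Real.sqrt_nonneg _
  set E0 := degLen F 0 1 γ0 with hE0d
  have hE00 : 0 ≤ E0 := degLen_nonneg hF0 zero_le_one
  have hE0 : ∀ (γ : ℝ → ℝ × ℝ) (K : ℝ≥0), LipschitzWith K γ → γ 0 = pm → γ 1 = pp → E0 ≤ degLen F 0 1 γ :=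
    fun γ K h h0 h1 => hmin 0 1 γ ⟨zero_le_one, h.locallyLipschitz, h0, h1⟩
  obtain ⟨g, ⟨Kg, hg⟩, hgeq⟩ := clip zero_le_one hγ0.2.1
  have hg0 : g 0 = pm := (hgeq 0 (left_mem_Icc.2 zero_le_one)).trans hγ0.2.2.1
  have hg1 : g 1 = pp := (hgeq 1 (right_mem_Icc.2 zero_le_one)).trans hγ0.2.2.2
  have hgE : degLen F 0 1 g = E0 := degLen_congr zero_le_one (fun t ht => hgeq t ⟨ht.1.le, ht.2.le⟩)
  have hgA : sArea 0 1 g = sArea 0 1 γ0 := sArea_congr zero_le_one (fun t ht => hgeq t ⟨ht.1.le, ht.2.le⟩)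
  obtain ⟨ρm, hρm, cm, hcm, Cm, hCm, hwm⟩ := well_bounds hW.smooth hW.nonneg ((hW.zeroSet pm).2 (Or.inl rfl)) hW.hess_m
  obtain ⟨ρp, hρp, cp, hcp, Cp, hCp, hwp⟩ := well_bounds hW.smooth hW.nonneg ((hW.zeroSet pp).2 (Or.inr rfl)) hW.hess_p
  obtain ⟨C3, hC3, hshear⟩ := shear hW hF E0 hE0
  set c := min cm cp with hc
  set C := max Cm Cp with hC
  have hcp0 : 0 < c := lt_min hcm hcp
  have hCp0 : 0 < C := lt_max_of_lt_left hCm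
  set ρ := min (min ρm ρp) (c / (16 * C3 * C)) with hρ
  have hρp0 : 0 < ρ := lt_min (lt_min hρm hρp) (by positivity)
  obtain ⟨s1, hs1, ε1, hε1, hε11, hs11, hsh⟩ := hshear (c / 4) (by positivity)
  set ξ := min (c * ρ ^ 2 / 8) (c * s1 / 4) with hξ
  have hξ0 : 0 < ξ := lt_min (by positivity) (by positivity)
  have hξ1 : ξ ≤ c * ρ ^ 2 / 8 := min_le_left _ _
  have hξ2 : ξ ≤ c * s1 / 4 := min_le_right _ _
  set ε := min ε1 ξ with hε
  have hε0 : 0 < ε := lt_min hε1 hξ0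
  have hεξ : ε ≤ ξ := min_le_right _ _
  have hεε : ε ≤ ε1 := min_le_left _ _
  set ρ1 := min ρ √(ξ / (2 * C)) with hρ1
  have hρ10 : 0 < ρ1 := lt_min hρp0 (Real.sqrt_pos.2 (by positivity))
  have hρ1ξ : 2 * C * ρ1 ^ 2 ≤ ξ := by
    have : ρ1 ^ 2 ≤ ξ / (2 * C) := by
      calc ρ1 ^ 2 ≤ √(ξ / (2 * C)) ^ 2 := by gcongr; exact min_le_right _ _
        _ = _ := Real.sq_sqrt (by positivity)
    rw [le_div_iff₀ (by positivity)] at this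
    linarith
  obtain ⟨m0, hm0, haw⟩ := away_bound hW hρ10
  have hshε : ShearOK F pm pp E0 C3 (c / 4) s1 ε := fun γ K h h0 h1 hE => hsh γ K h h0 h1 (by linarith)
  have hlom : ∀ x, ‖x - pm‖ ≤ ρ → c * ‖x - pm‖ ≤ F x := fun x hx => by
    rw [hF]
    refine le_trans ?_ (hwm x (hx.trans ((min_le_left _ _).trans (min_le_left _ _)))).1
    gcongr; exact min_le_left _ _
  have hlop : ∀ x, ‖x - pp‖ ≤ ρ → c * ‖x - pp‖ ≤ F x := fun x hx => by
    rw [hF]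
    refine le_trans ?_ (hwp x (hx.trans ((min_le_left _ _).trans (min_le_right _ _)))).1
    gcongr; exact min_le_right _ _
  have hupm : ∀ x, ‖x - pm‖ ≤ ρ → F x ≤ C * ‖x - pm‖ := fun x hx => by
    rw [hF]
    refine (hwm x (hx.trans ((min_le_left _ _).trans (min_le_left _ _)))).2.trans ?_
    gcongr; exact le_max_left _ _
  have hupp : ∀ x, ‖x - pp‖ ≤ ρ → F x ≤ C * ‖x - pp‖ := fun x hx => by
    rw [hF]
    refine (hwp x (hx.trans ((min_le_left _ _).trans (min_le_right _ _)))).2.trans ?_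
    gcongr; exact le_max_right _ _
  have k1 : C3 * (2 / c) * (2 * (C * ρ)) ≤ 1 / 4 := by
    have : ρ ≤ c / (16 * C3 * C) := min_le_right _ _
    calc C3 * (2 / c) * (2 * (C * ρ)) ≤ C3 * (2 / c) * (2 * (C * (c / (16 * C3 * C)))) := by gcongr
      _ = 1 / 4 := by field_simp; norm_num
  have k2 : ε + 2 * C * ρ1 ^ 2 < c / 2 * ρ ^ 2 := by
    have : 0 < c * ρ ^ 2 := by positivity
    linarith
  have k3 : (2 / c) * (ε + 2 * C * ρ1 ^ 2) ≤ s1 := by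
    calc (2 / c) * (ε + 2 * C * ρ1 ^ 2) ≤ (2 / c) * (c * s1 / 4 + c * s1 / 4) := by gcongr <;> linarith
      _ = s1 := by field_simp; norm_num
  refine ⟨min s1 (ε * 4 / c), lt_min hs1 (by positivity), fun A hA => ?_⟩
  obtain ⟨γA, KA, hγA, hγA0, hγA1, hγAA, hγAE, -⟩ := hshε g Kg hg hg0 hg1 (by rw [hgE]; linarith) (A - sArea 0 1 γ0)
    (hA.le.trans (min_le_left _ _))
  rw [hgA, add_sub_cancel] at hγAA
  have hγAE' : degLen F 0 1 γA ≤ E0 + ε := by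
    refine hγAE.trans ?_
    rw [hgE]
    have : |A - sArea 0 1 γ0| ≤ ε * 4 / c := hA.le.trans (min_le_right _ _)
    have : c / 4 * |A - sArea 0 1 γ0| ≤ c / 4 * (ε * 4 / c) := by gcongr
    have e : c / 4 * (ε * 4 / c) = ε := by field_simp
    linarith
  set L1 := 4 / (min (c / √(8 * C)) (m0 / √(E0 + 1))) * √(E0 + 1) with hL1
  have hclass : ∀ L : ℝ≥0, Len 0 1 γA < L → ∃ γ, (LipschitzWith L γ ∧ γ 0 = pm ∧ γ 1 = pp ∧ sArea 0 1 γ = A) ∧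
      (∀ γ', LipschitzWith L γ' → γ' 0 = pm → γ' 1 = pp → sArea 0 1 γ' = A → degLen F 0 1 γ ≤ degLen F 0 1 γ') ∧ Len 0 1 γ ≤ L1 := by
    intro L hL
    obtain ⟨γB, b1, b2, b3, b4, b5⟩ := reparam hFc hγA zero_lt_one hL
    obtain ⟨γ, ⟨d1, d2, d3, d4⟩, dm⟩ := exists_min hFc hF0 L pm pp A ⟨γB, b1, b2.trans hγA0, b3.trans hγA1, b5.trans hγAA⟩
    refine ⟨γ, ⟨d1, d2, d3, d4⟩, dm, ?_⟩
    have hle := dm γB b1 (b2.trans hγA0) (b3.trans hγA1) (b5.trans hγAA)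
    exact min_len hFc hF0 d1 hW.wells_ne hcp0 hCp0 hC3 hρp0 hρ10 hm0 hE00 (hεε.trans hε11) hE0 hshε hlom hupm hlop hupp
      (by rw [hF]; exact haw) k1 k2 k3 (min_le_left _ _) d2 d3 (by rw [b4] at hle; exact hle.trans hγAE')
      (fun γ' f1 f2 f3 f4 => dm γ' f1 f2 f3 (f4.trans d4))
  set L2 : ℝ≥0 := (max (L1 + 1) (Len 0 1 γA + 1)).toNNReal with hL2
  have hL2c : max (L1 + 1) (Len 0 1 γA + 1) ≤ (L2 : ℝ) := Real.le_coe_toNNReal _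
  have hL2a : L1 < L2 := by linarith [(le_max_left (L1 + 1) (Len 0 1 γA + 1)).trans hL2c]
  have hL2b : Len 0 1 γA < L2 := by linarith [(le_max_right (L1 + 1) (Len 0 1 γA + 1)).trans hL2c]
  obtain ⟨γs, ⟨s1', s2, s3, s4⟩, smin, -⟩ := hclass L2 hL2b
  refine ⟨0, 1, γs, ⟨zero_le_one, s1'.locallyLipschitz, s2, s3⟩, s4, ?_⟩
  rintro a b γ' ⟨hab, hloc, ha, hb⟩ hA'
  obtain ⟨γc, ⟨Kc, hγc⟩, hceq⟩ := clip hab hloc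
  have hab' : a < b := by
    rcases hab.eq_or_lt with h | h
    · exact absurd (by rw [← ha, ← hb, h]) hW.wells_ne
    · exact h
  have hcE : degLen F a b γc = degLen F a b γ' := degLen_congr hab (fun t ht => hceq t ⟨ht.1.le, ht.2.le⟩)
  have hcA : sArea a b γc = sArea a b γ' := sArea_congr hab (fun t ht => hceq t ⟨ht.1.le, ht.2.le⟩)
  set L : ℝ≥0 := max L2 (Len a b γc + 1).toNNReal with hL
  have hLa : (L2 : ℝ) ≤ L := NNReal.coe_le_coe.2 (le_max_left _ _)
  have hLb : Len a b γc + 1 ≤ L := (Real.le_coe_toNNReal _).trans (NNReal.coe_le_coe.2 (le_max_right _ _))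
  obtain ⟨γr, r1, r2, r3, r4, r5⟩ := reparam hFc hγc hab' (L := L) (by linarith)
  obtain ⟨γL, ⟨l1, l2, l3, l4⟩, lmin, lLen⟩ := hclass L (by linarith)
  have q1 := lmin γr r1 (by rw [r2, hceq a (left_mem_Icc.2 hab), ha]) (by rw [r3, hceq b (right_mem_Icc.2 hab), hb]) (by rw [r5, hcA, hA'])
  obtain ⟨γt, t1, t2, t3, t4, t5⟩ := reparam hFc l1 zero_lt_one (L := L2) (lLen.trans_lt hL2a)
  have q2 := smin γt t1 (t2.trans l2) (t3.trans l3) (t5.trans l4)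
  rw [t4] at q2
  rw [r4, hcE] at q1
  exact q2.trans q1
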